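/- arXiv:1908.09905 — 3 statements merged into one kernel-verified Lean document; each statement's English description precedes it below -/
import Mathlib

section
/- For all fixed integers k > s ≥ 3, the limit as n → ∞ of (log f_{s,k}(n))/(log n) exists and equals 2. Equivalently: for every ε > 0 there exists n₀ such that for all n ≥ n₀ one has n^{2-ε} ≤ f_{s,k}(n) ≤ n^{2+ε}. -/
open Finset Pointwise

/-- The `k`-term arithmetic progression `{x, x+d, …, x+(k-1)d}` as a finite set. -/
def AP (k : ℕ) (x d : ℤ) : Finset ℤ := (Finset.range k).image (fun i : ℕ => x + (i : ℤ) * d)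

/-- A set of integers is `k`-AP free if it contains no nontrivial `k`-term
arithmetic progression. -/
def APFree (k : ℕ) (A : Set ℤ) : Prop :=
  ∀ x d : ℤ, d ≠ 0 → ¬ (↑(AP k x d) : Set ℤ) ⊆ A

/-- `fAP s A` is the number of nontrivial `s`-term arithmetic progressions contained
in the finite set `A`. -/
noncomputable def fAP (s : ℕ) (A : Finset ℤ) : ℕ :=
  Nat.card {P : Finset ℤ // P ⊆ A ∧ ∃ x d : ℤ, d ≠ 0 ∧ P = AP s x d}

/-- `fsk s k n` is the maximum number of nontrivial `s`-term arithmetic progressions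
in a `k`-AP free set of `n` integers. -/
noncomputable def fsk (s k n : ℕ) : ℕ :=
  sSup {m | ∃ A : Finset ℤ, A.card = n ∧ APFree k ↑A ∧ fAP s A = m}

/-- `rk k n` is the size of the largest `k`-AP free subset of `{1, …, n}`. -/
noncomputable def rk (k n : ℕ) : ℕ :=
  sSup {m | ∃ A : Finset ℤ, A ⊆ Finset.Icc 1 (n : ℤ) ∧ APFree k ↑A ∧ A.card = m}

/-- The partial sumset `A +_G B` along the edge set `E` of a bipartite graph. -/
def partialSumset (E : Finset (ℤ × ℤ)) : Finset ℤ := E.image (fun e => e.1 + e.2)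

/-- `pathCount A B E a a'` is the number of (ordered) paths `(a, b, a'', b', a')` of
length four between `a` and `a'` in the bipartite graph with parts `A`, `B` and
edge set `E`. -/
def pathCount (A B : Finset ℤ) (E : Finset (ℤ × ℤ)) (a a' : ℤ) : ℕ :=
  ((B ×ˢ A ×ˢ B).filter (fun t =>
    (a, t.1) ∈ E ∧ (t.2.1, t.1) ∈ E ∧ (t.2.1, t.2.2) ∈ E ∧ (a', t.2.2) ∈ E)).card

lemma mem_AP_iff {k : ℕ} {x d y : ℤ} : y ∈ AP k x d ↔ ∃ i : ℕ, i < k ∧ x + (i : ℤ) * d = y := by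
  simp [AP]

lemma fAP_le (s : ℕ) (hs : 3 ≤ s) (A : Finset ℤ) : fAP s A ≤ A.card ^ 2 := by
  classical
  unfold fAP
  have key : ∀ P : {P : Finset ℤ // P ⊆ A ∧ ∃ x d : ℤ, d ≠ 0 ∧ P = AP s x d},
      ∃ q : A × A, P.1 = AP s q.1.1 (q.2.1 - q.1.1) := by
    rintro ⟨P, hPA, x, d, hd, rfl⟩
    have h0 : x ∈ A := hPA (mem_AP_iff.2 ⟨0, by omega, by simp⟩)
    have h1 : x + d ∈ A := hPA (mem_AP_iff.2 ⟨1, by omega, by simp⟩)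
    exact ⟨(⟨x, h0⟩, ⟨x + d, h1⟩), by simp⟩
  choose g hg using key
  have hinj : Function.Injective g := by
    intro P Q h
    apply Subtype.ext
    rw [hg P, hg Q, h]
  have := Nat.card_le_card_of_injective g hinj
  rw [Nat.card_prod] at this
  simpa [sq] using this

lemma le_fsk (s k n : ℕ) (hs : 3 ≤ s) (A : Finset ℤ) (hA : A.card = n)
    (hf : APFree k (A : Set ℤ)) : fAP s A ≤ fsk s k n := by
  unfold fsk
  apply le_csSup
  · refine ⟨n ^ 2, ?_⟩
    rintro m ⟨B, hB, -, rfl⟩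
    rw [← hB]
    exact fAP_le s hs B
  · exact ⟨A, hA, hf, rfl⟩

lemma fsk_le (s k n : ℕ) (hs : 3 ≤ s) : fsk s k n ≤ n ^ 2 := by
  unfold fsk
  apply csSup_le'
  rintro m ⟨B, hB, -, rfl⟩
  rw [← hB]
  exact fAP_le s hs B

lemma fAP_mono (s : ℕ) {A B : Finset ℤ} (h : A ⊆ B) : fAP s A ≤ fAP s B := by
  unfold fAP
  have : Finite {P : Finset ℤ // P ⊆ B ∧ ∃ x d : ℤ, d ≠ 0 ∧ P = AP s x d} := by
    apply Set.Finite.to_subtype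
    apply (B.powerset.finite_toSet).subset
    rintro P ⟨hP, -⟩
    simpa using hP
  exact Nat.card_le_card_of_injective
    (fun P => (⟨P.1, P.2.1.trans h, P.2.2⟩ :
      {P : Finset ℤ // P ⊆ B ∧ ∃ x d : ℤ, d ≠ 0 ∧ P = AP s x d}))
    (fun P Q hPQ => Subtype.ext (by simpa using hPQ))

lemma exists_insert (k : ℕ) (hk : 3 ≤ k) (A : Finset ℤ) (hf : APFree k (A : Set ℤ)) :
    ∃ y, y ∉ A ∧ APFree k ((insert y A : Finset ℤ) : Set ℤ) := by
  classical
  obtain ⟨K, hK0, hK⟩ : ∃ K : ℤ, 0 ≤ K ∧ ∀ a ∈ A, |a| ≤ K :=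
    ⟨∑ a ∈ A, |a|, Finset.sum_nonneg (fun a _ => abs_nonneg a),
      fun a ha => Finset.single_le_sum (f := fun a : ℤ => |a|) (fun a _ => abs_nonneg a) ha⟩
  refine ⟨3 * K + 1, ?_, ?_⟩
  · intro h
    have := hK _ h
    rw [abs_le] at this
    omega
  · intro x d hd hsub
    have hmem : ∀ i : ℕ, i < k → x + (i : ℤ) * d = 3 * K + 1 ∨ x + (i : ℤ) * d ∈ A := by
      intro i hi
      have := hsub (Finset.mem_coe.2 (mem_AP_iff.2 ⟨i, hi, rfl⟩))
      simpa using this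
    by_cases hall : ∀ i : ℕ, i < k → x + (i : ℤ) * d ∈ A
    · apply hf x d hd
      intro y hy
      obtain ⟨i, hi, rfl⟩ := mem_AP_iff.1 (Finset.mem_coe.1 hy)
      exact hall i hi
    · push Not at hall
      obtain ⟨i, hi, hiA⟩ := hall
      have hiy := (hmem i hi).resolve_right hiA
      have hoth : ∀ j : ℕ, j < k → j ≠ i → |x + (j : ℤ) * d| ≤ K := by
        intro j hj hji
        apply hK
        refine (hmem j hj).resolve_left ?_
        intro h
        have h2 : ((j : ℤ) - i) * d = 0 := by linarith
        rcases mul_eq_zero.1 h2 with h3 | h3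
        · omega
        · exact hd h3
      have hcase : ∃ j l : ℕ, j < k ∧ l < k ∧ j ≠ i ∧ l ≠ i ∧
          ((l : ℤ) + i = 2 * j ∨ (l : ℤ) + j = 2 * i) := by
        rcases Nat.lt_or_ge i 2 with h | h
        · interval_cases i
          · exact ⟨1, 2, by omega, by omega, by omega, by omega, by simp⟩
          · exact ⟨0, 2, by omega, by omega, by omega, by omega, by simp⟩
        · exact ⟨i - 1, i - 2, by omega, by omega, by omega, by omega, by omega⟩
      obtain ⟨j, l, hj, hl, hji, hli, hjl⟩ := hcase
      have h1 := abs_le.1 (hoth j hj hji)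
      have h2 := abs_le.1 (hoth l hl hli)
      rcases hjl with h | h
      · have : (l : ℤ) * d + i * d = 2 * (j * d) := by linear_combination d * h
        omega
      · have : (l : ℤ) * d + j * d = 2 * (i * d) := by linear_combination d * h
        omega

lemma exists_pad (k : ℕ) (hk : 3 ≤ k) (m : ℕ) : ∀ A : Finset ℤ, APFree k (A : Set ℤ) →
    ∃ B : Finset ℤ, A ⊆ B ∧ B.card = A.card + m ∧ APFree k (B : Set ℤ) := by
  classical
  induction m with
  | zero => exact fun A hA => ⟨A, subset_rfl, rfl, hA⟩
  | succ m ih =>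
    intro A hA
    obtain ⟨y, hy, hyA⟩ := exists_insert k hk A hA
    obtain ⟨B, hB, hc, hBf⟩ := ih _ hyA
    refine ⟨B, (Finset.subset_insert y A).trans hB, ?_, hBf⟩
    rw [hc, Finset.card_insert_of_notMem hy]
    omega

lemma AP_inj {s : ℕ} (hs : 3 ≤ s) {x d x' d' : ℤ} (hd : 0 < d) (hd' : 0 < d')
    (h : AP s x d = AP s x' d') : x = x' ∧ d = d' := by
  have aux : ∀ x d x' d' : ℤ, 0 < d → 0 < d' → AP s x d = AP s x' d' → x' ≤ x := by
    intro x d x' d' _ hd' h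
    have h0 : x ∈ AP s x d := mem_AP_iff.2 ⟨0, by omega, by simp⟩
    rw [h] at h0
    obtain ⟨i, _, hi⟩ := mem_AP_iff.1 h0
    have : 0 ≤ (i : ℤ) * d' := by positivity
    omega
  have hx : x = x' := le_antisymm (aux _ _ _ _ hd' hd h.symm) (aux _ _ _ _ hd hd' h)
  subst hx
  have aux2 : ∀ d d' : ℤ, 0 < d → 0 < d' → AP s x d = AP s x d' → d' ≤ d := by
    intro d d' hd hd' h
    have h0 : x + d ∈ AP s x d := mem_AP_iff.2 ⟨1, by omega, by simp⟩
    rw [h] at h0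
    obtain ⟨i, _, hi⟩ := mem_AP_iff.1 h0
    rcases Nat.eq_zero_or_pos i with rfl | hi0
    · simp at hi; omega
    · have : (1 : ℤ) ≤ i := by exact_mod_cast hi0
      nlinarith
  exact ⟨rfl, le_antisymm (aux2 _ _ hd' hd h.symm) (aux2 _ _ hd hd' h)⟩

/-- Averaging over shifts. -/
lemma exists_shift (s N : ℕ) (hN : 1 ≤ N) (X : Finset ℤ) (hX : ∀ a ∈ X, 0 ≤ a ∧ a < N) :
    ∃ t : Fin s → ℤ, (∀ i, -(N : ℤ) ≤ t i ∧ t i ≤ s * N) ∧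
      N ^ 2 * X.card ^ s ≤
        (((Finset.Ico (0 : ℤ) N) ×ˢ (Finset.Ico (0 : ℤ) N)).filter
          (fun p => ∀ i : Fin s, p.1 + (i : ℤ) * p.2 - t i ∈ X)).card * ((s + 2) * N) ^ s := by
  classical
  set T : Finset ℤ := Finset.Icc (-(N : ℤ)) (s * N) with hT
  set Q := (Finset.Ico (0 : ℤ) N) ×ˢ (Finset.Ico (0 : ℤ) N) with hQ
  set TT : Finset (Fin s → ℤ) := Fintype.piFinset (fun _ => T) with hTT
  have hTc : T.card ≤ (s + 2) * N := by
    rw [hT, Int.card_Icc]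
    zify
    rw [Int.toNat_of_nonneg (by nlinarith [Int.natCast_nonneg N, Int.natCast_nonneg s, mul_nonneg (Int.natCast_nonneg s) (Int.natCast_nonneg N)])]
    push_cast
    nlinarith
  have hTTc : TT.card ≤ ((s + 2) * N) ^ s := by
    rw [hTT, Fintype.card_piFinset]
    simpa using Nat.pow_le_pow_left hTc s
  have hQc : Q.card = N ^ 2 := by simp [hQ, sq]
  have hcount : ∀ p ∈ Q, (TT.filter (fun t => ∀ i : Fin s, p.1 + (i : ℤ) * p.2 - t i ∈ X)).card
      = X.card ^ s := by
    intro p hp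
    have hp' : (0 ≤ p.1 ∧ p.1 < N) ∧ (0 ≤ p.2 ∧ p.2 < N) := by
      simpa [hQ, Finset.mem_product] using hp
    have heq : TT.filter (fun t => ∀ i : Fin s, p.1 + (i : ℤ) * p.2 - t i ∈ X)
        = Fintype.piFinset (fun i : Fin s => X.image (fun a => p.1 + (i : ℤ) * p.2 - a)) := by
      ext t
      simp only [hTT, Finset.mem_filter, Fintype.mem_piFinset, Finset.mem_image]
      constructor
      · rintro ⟨-, h⟩ i
        exact ⟨_, h i, by ring⟩
      · intro h
        refine ⟨fun i => ?_, fun i => ?_⟩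
        · obtain ⟨a, ha, hai⟩ := h i
          have := hX a ha
          have h1 : (0 : ℤ) ≤ (i : ℤ) * p.2 := mul_nonneg (by positivity) hp'.2.1
          have hi : ((i : ℕ) : ℤ) + 1 ≤ s := by exact_mod_cast i.2
          have h2 : (i : ℤ) * p.2 ≤ (s - 1) * N :=
            mul_le_mul (by linarith) hp'.2.2.le hp'.2.1 (by linarith [Int.natCast_nonneg (i : ℕ)])
          rw [hT, Finset.mem_Icc]
          constructor <;> nlinarith
        · obtain ⟨a, ha, hai⟩ := h i
          rw [← hai]
          simpa using ha
    rw [heq, Fintype.card_piFinset]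
    have : ∀ i : Fin s, (X.image (fun a => p.1 + (i : ℤ) * p.2 - a)).card = X.card := by
      intro i
      apply Finset.card_image_of_injective
      intro a b hab
      simpa using hab
    simp [this]
  have hdouble : ∑ t ∈ TT, (Q.filter (fun p => ∀ i : Fin s, p.1 + (i : ℤ) * p.2 - t i ∈ X)).card
      = N ^ 2 * X.card ^ s := by
    have := Finset.sum_card_bipartiteAbove_eq_sum_card_bipartiteBelow (s := TT) (t := Q)
      (fun (t : Fin s → ℤ) (p : ℤ × ℤ) => ∀ i : Fin s, p.1 + (i : ℤ) * p.2 - t i ∈ X)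
    simp only [Finset.bipartiteAbove, Finset.bipartiteBelow] at this
    rw [this, Finset.sum_congr rfl hcount, Finset.sum_const, hQc, smul_eq_mul]
  have hne : TT.Nonempty := by
    refine ⟨fun _ => 0, ?_⟩
    simp only [hTT, Fintype.mem_piFinset, hT, Finset.mem_Icc]
    intro _
    constructor
    · simp
    · positivity
  obtain ⟨t, ht, hmax⟩ := Finset.exists_max_image TT
    (fun t => (Q.filter (fun p => ∀ i : Fin s, p.1 + (i : ℤ) * p.2 - t i ∈ X)).card) hne
  refine ⟨t, ?_, ?_⟩
  · intro i
    have := Fintype.mem_piFinset.1 ht i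
    simpa [hT] using this
  · rw [← hdouble]
    refine (Finset.sum_le_card_nsmul TT _ _ hmax).trans ?_
    rw [smul_eq_mul, mul_comm]
    exact Nat.mul_le_mul_left _ hTTc

lemma exists_construction (s k N : ℕ) (hs : 3 ≤ s) (hk : s < k) (hN : 1 ≤ N) (X : Finset ℤ)
    (hX : ∀ a ∈ X, 0 ≤ a ∧ a < N) (hX3 : ThreeAPFree (X : Set ℤ)) :
    ∃ A : Finset ℤ, A.card ≤ s * N ∧ APFree k (A : Set ℤ) ∧
      N ^ 2 * X.card ^ s ≤ fAP s A * ((s + 2) * N) ^ s := by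
  classical
  obtain ⟨t, ht, hcount⟩ := exists_shift s N hN X hX
  set K : ℤ := (s + 1) * N with hK
  have hK0 : 0 ≤ K := by positivity
  set M : ℤ := 4 * K + 1 with hM
  set A : Finset ℤ := ((Finset.univ : Finset (Fin s)) ×ˢ X).image
    (fun q => M * (q.1 : ℤ) + (t q.1 + q.2)) with hA
  have memA : ∀ y, y ∈ A ↔ ∃ i : Fin s, ∃ a ∈ X, M * (i : ℤ) + (t i + a) = y := by
    intro y
    simp [hA]
  have hbd : ∀ i : Fin s, ∀ a ∈ X, |t i + a| ≤ K := by
    intro i a ha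
    have h1 := ht i
    have h2 := hX a ha
    have h3 : (0 : ℤ) ≤ s * N := by positivity
    rw [abs_le, hK]
    constructor <;> nlinarith
  refine ⟨A, ?_, ?_, ?_⟩
  · have hXc : X.card ≤ N := by
      have : X ⊆ Finset.Ico (0 : ℤ) N := fun a ha => Finset.mem_Ico.2 (hX a ha)
      simpa using Finset.card_le_card this
    refine Finset.card_image_le.trans ?_
    rw [Finset.card_product]
    simpa using Nat.mul_le_mul_left s hXc
  · intro x D hD hsub
    have hmem : ∀ j : ℕ, ∃ i : Fin s, ∃ a ∈ X, j < k → M * (i : ℤ) + (t i + a) = x + (j : ℤ) * D := by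
      intro j
      by_cases hj : j < k
      · have := hsub (Finset.mem_coe.2 (mem_AP_iff.2 ⟨j, hj, rfl⟩))
        obtain ⟨i, a, ha, h⟩ := (memA _).1 (Finset.mem_coe.1 this)
        exact ⟨i, a, ha, fun _ => h⟩
      · have := hsub (Finset.mem_coe.2 (mem_AP_iff.2 ⟨0, by omega, rfl⟩))
        obtain ⟨i, a, ha, h⟩ := (memA _).1 (Finset.mem_coe.1 this)
        exact ⟨i, a, ha, fun h' => absurd h' hj⟩
    choose I a ha hIa using hmem
    have hsecond : ∀ j : ℕ, j + 2 < k →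
        ((I (j + 2) : ℕ) : ℤ) - 2 * (I (j + 1) : ℕ) + (I j : ℕ) = 0 := by
      intro j hj
      have e0 := hIa j (by omega)
      have e1 := hIa (j + 1) (by omega)
      have e2 := hIa (j + 2) hj
      have b0 := abs_le.1 (hbd (I j) _ (ha j))
      have b1 := abs_le.1 (hbd (I (j + 1)) _ (ha (j + 1)))
      have b2 := abs_le.1 (hbd (I (j + 2)) _ (ha (j + 2)))
      push_cast at e0 e1 e2
      set z : ℤ := ((I (j + 2) : ℕ) : ℤ) - 2 * (I (j + 1) : ℕ) + (I j : ℕ) with hz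
      have hMz : M * z = -((t (I (j + 2)) + a (j + 2)) - 2 * (t (I (j + 1)) + a (j + 1))
          + (t (I j) + a j)) := by
        rw [hz]; linear_combination e2 - 2 * e1 + e0
      have hlt : |M * z| < M := by
        rw [hMz, abs_lt]
        constructor <;> linarith
      by_contra hne
      have h1 : 1 ≤ |z| := Int.one_le_abs hne
      rw [abs_mul, abs_of_pos (by omega : 0 < M)] at hlt
      nlinarith
    set e : ℤ := ((I 1 : ℕ) : ℤ) - (I 0 : ℕ) with he
    have hlin : ∀ j : ℕ, j + 1 < k → ((I j : ℕ) : ℤ) = (I 0 : ℕ) + j * e ∧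
        ((I (j + 1) : ℕ) : ℤ) = (I 0 : ℕ) + (j + 1) * e := by
      intro j
      induction j with
      | zero => intro _; simp [he]
      | succ j ih =>
        intro hj
        obtain ⟨h1, h2⟩ := ih (by omega)
        have h3 := hsecond j hj
        push_cast
        refine ⟨h2, ?_⟩
        have : j + 1 + 1 = j + 2 := rfl
        rw [this]
        linear_combination h3 + 2 * h2 - h1
    have hs1 := (hlin (s - 1) (by omega)).2
    rw [Nat.sub_add_cancel (by omega : 1 ≤ s)] at hs1
    have hcast : ((s - 1 : ℕ) : ℤ) + 1 = s := by omega
    rw [hcast] at hs1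
    have he0 : e = 0 := by
      have u1 : ((I s : ℕ) : ℤ) < s := by exact_mod_cast (I s).2
      have u2 : ((I 0 : ℕ) : ℤ) < s := by exact_mod_cast (I 0).2
      have u3 : (0 : ℤ) ≤ ((I s : ℕ) : ℤ) := by positivity
      have u4 : (0 : ℤ) ≤ ((I 0 : ℕ) : ℤ) := by positivity
      have hs0 : (0 : ℤ) < s := by positivity
      rcases lt_trichotomy e 0 with h | h | h
      · nlinarith
      · exact h
      · nlinarith
    have i1 : I 1 = I 0 := by
      apply Fin.ext
      omega
    have i2 : I 2 = I 0 := by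
      have := (hlin 1 (by omega)).2
      rw [he0] at this
      apply Fin.ext
      simp at this
      omega
    have e0 := hIa 0 (by omega)
    have e1 := hIa 1 (by omega)
    have e2 := hIa 2 (by omega)
    rw [i1] at e1
    rw [i2] at e2
    push_cast at e0 e1 e2
    have h01 : a 0 = a 1 := hX3 (ha 0) (ha 1) (ha 2) (by linarith)
    apply hD
    rw [h01] at e0
    linarith
  · refine hcount.trans (Nat.mul_le_mul_right _ ?_)
    unfold fAP
    have : Finite {P : Finset ℤ // P ⊆ A ∧ ∃ x d : ℤ, d ≠ 0 ∧ P = AP s x d} := by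
      apply Set.Finite.to_subtype
      apply (A.powerset.finite_toSet).subset
      rintro P ⟨hP, -⟩
      simpa using hP
    rw [← Nat.card_eq_finsetCard]
    have hprop : ∀ p ∈ ((Finset.Ico (0 : ℤ) N) ×ˢ (Finset.Ico (0 : ℤ) N)).filter
          (fun p => ∀ i : Fin s, p.1 + (i : ℤ) * p.2 - t i ∈ X),
        0 < M + p.2 ∧ AP s p.1 (M + p.2) ⊆ A := by
      intro p hp
      rw [Finset.mem_filter, Finset.mem_product, Finset.mem_Ico, Finset.mem_Ico] at hp
      obtain ⟨⟨-, h2, -⟩, h3⟩ := hp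
      refine ⟨by omega, ?_⟩
      intro y hy
      obtain ⟨i, hi, rfl⟩ := mem_AP_iff.1 hy
      exact (memA _).2 ⟨⟨i, hi⟩, _, h3 ⟨i, hi⟩, by simp only; ring⟩
    refine Nat.card_le_card_of_injective
      (fun p => (⟨AP s p.1.1 (M + p.1.2), (hprop p.1 p.2).2, p.1.1, M + p.1.2,
        (hprop p.1 p.2).1.ne', rfl⟩ :
        {P : Finset ℤ // P ⊆ A ∧ ∃ x d : ℤ, d ≠ 0 ∧ P = AP s x d})) ?_
    intro p q hpq
    have h := AP_inj hs (hprop p.1 p.2).1 (hprop q.1 q.2).1 (congrArg Subtype.val hpq)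
    apply Subtype.ext
    apply Prod.ext
    · exact h.1
    · have := h.2
      omega

lemma fsk_lower (s k n : ℕ) (hs : 3 ≤ s) (hk : s < k) (hn : s ≤ n) :
    (n : ℝ) ^ 2 * Real.exp (-(4 * s * √(Real.log n))) ≤
      fsk s k n * (4 * s ^ 2 * (s + 2) ^ s : ℝ) := by
  classical
  set N := n / s with hNdef
  have hN : 1 ≤ N := (Nat.one_le_div_iff (by omega)).2 hn
  have hsN : s * N ≤ n := Nat.mul_div_le n s
  have hnN : n ≤ 2 * s * N := by
    have h1 : n < s * N + s := by
      have := Nat.div_add_mod n s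
      have h2 := Nat.mod_lt n (by omega : s > 0)
      rw [hNdef]; omega
    nlinarith
  obtain ⟨X₀, hX₀, hX₀c, hX₀f⟩ := rothNumberNat_spec N
  set X : Finset ℤ := X₀.image (fun a : ℕ => (a : ℤ)) with hXdef
  have hXc : X.card = rothNumberNat N := by
    rw [hXdef, Finset.card_image_of_injective _ Nat.cast_injective, hX₀c]
  have hX : ∀ a ∈ X, 0 ≤ a ∧ a < N := by
    intro a ha
    obtain ⟨b, hb, rfl⟩ := Finset.mem_image.1 ha
    have := Finset.mem_range.1 (hX₀ hb)
    constructor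
    · positivity
    · exact_mod_cast this
  have hX3 : ThreeAPFree (X : Set ℤ) := by
    intro a ha b hb c hc habc
    obtain ⟨a, ha', rfl⟩ := Finset.mem_image.1 (Finset.mem_coe.1 ha)
    obtain ⟨b, hb', rfl⟩ := Finset.mem_image.1 (Finset.mem_coe.1 hb)
    obtain ⟨c, hc', rfl⟩ := Finset.mem_image.1 (Finset.mem_coe.1 hc)
    have h : a + c = b + b := by exact_mod_cast habc
    exact_mod_cast hX₀f ha' hb' hc' h
  obtain ⟨A, hAc, hAf, hAcount⟩ := exists_construction s k N hs hk hN X hX hX3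
  obtain ⟨B, hAB, hBc, hBf⟩ := exists_pad k (by omega) (n - A.card) A hAf
  have hle : fAP s A ≤ fsk s k n :=
    (fAP_mono s hAB).trans (le_fsk s k n hs B (by omega) hBf)
  have hmain : N ^ 2 * X.card ^ s ≤ fsk s k n * ((s + 2) * N) ^ s :=
    hAcount.trans (Nat.mul_le_mul_right _ hle)
  have hmainR : (N : ℝ) ^ 2 * (X.card : ℝ) ^ s ≤ fsk s k n * ((s + 2) * N) ^ s := by
    exact_mod_cast hmain
  have hNpos : (0 : ℝ) < N := by exact_mod_cast hN
  have hroth : (N : ℝ) * Real.exp (-4 * √(Real.log n)) ≤ X.card := by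
    rw [hXc]
    refine le_trans ?_ Behrend.roth_lower_bound
    have hNn : (N : ℝ) ≤ n := by exact_mod_cast (Nat.div_le_self n s)
    have : √(Real.log N) ≤ √(Real.log n) := Real.sqrt_le_sqrt (Real.log_le_log hNpos hNn)
    apply mul_le_mul_of_nonneg_left _ hNpos.le
    apply Real.exp_le_exp.2
    linarith
  have hpow : (N : ℝ) ^ s * Real.exp (-(4 * s * √(Real.log n))) ≤ (X.card : ℝ) ^ s := by
    have := pow_le_pow_left₀ (by positivity) hroth s
    rw [mul_pow, ← Real.exp_nat_mul] at this
    have e : (s : ℝ) * (-4 * √(Real.log n)) = -(4 * s * √(Real.log n)) := by ring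
    rwa [e] at this
  have hE : 0 < Real.exp (-(4 * s * √(Real.log n))) := Real.exp_pos _
  set E := Real.exp (-(4 * s * √(Real.log n)))
  have h1 : (N : ℝ) ^ 2 * E ≤ fsk s k n * (s + 2) ^ s := by
    have h2 : (N : ℝ) ^ s * ((N : ℝ) ^ 2 * E) ≤ (N : ℝ) ^ s * (fsk s k n * (s + 2) ^ s) := by
      calc (N : ℝ) ^ s * ((N : ℝ) ^ 2 * E) = (N : ℝ) ^ 2 * ((N : ℝ) ^ s * E) := by ring
        _ ≤ (N : ℝ) ^ 2 * (X.card : ℝ) ^ s := by gcongr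
        _ ≤ _ := hmainR
        _ = _ := by rw [mul_pow]; ring
    exact le_of_mul_le_mul_left h2 (by positivity)
  have hnNR : (n : ℝ) ≤ 2 * s * N := by exact_mod_cast hnN
  calc (n : ℝ) ^ 2 * E ≤ (2 * s * N) ^ 2 * E := by gcongr
    _ = 4 * s ^ 2 * ((N : ℝ) ^ 2 * E) := by ring
    _ ≤ 4 * s ^ 2 * (fsk s k n * (s + 2) ^ s) := by gcongr
    _ = _ := by ring

theorem fsk_limit (k s : ℕ) (hs : 3 ≤ s) (hk : s < k) (ε : ℝ) (hε : 0 < ε) :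
    ∃ n₀ : ℕ, ∀ n : ℕ, n₀ ≤ n →
      (n : ℝ) ^ ((2 : ℝ) - ε) ≤ (fsk s k n : ℝ) ∧ (fsk s k n : ℝ) ≤ (n : ℝ) ^ ((2 : ℝ) + ε) := by
  set C : ℝ := 4 * s ^ 2 * (s + 2) ^ s with hC
  have hs0 : (0 : ℝ) < s := by exact_mod_cast (by omega : 0 < s)
  have hCpos : 0 < C := by positivity
  set R : ℝ := max 1 ((|Real.log C| + 4 * s) / ε) with hR
  have hR1 : 1 ≤ R := le_max_left _ _
  have hR2 : (|Real.log C| + 4 * s) / ε ≤ R := le_max_right _ _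
  refine ⟨max s ⌈Real.exp (R ^ 2)⌉₊, fun n hn => ?_⟩
  have hsn : s ≤ n := (le_max_left _ _).trans hn
  have hn1 : (1 : ℝ) ≤ n := by exact_mod_cast (by omega : 1 ≤ n)
  have hn0 : (0 : ℝ) < n := by linarith
  constructor
  · have hRn : Real.exp (R ^ 2) ≤ n :=
      (Nat.le_ceil _).trans (by exact_mod_cast (le_max_right _ _).trans hn)
    have hlog : R ^ 2 ≤ Real.log n := (Real.le_log_iff_exp_le hn0).2 hRn
    have hlog0 : 0 ≤ Real.log n := Real.log_nonneg hn1
    have hr : R ≤ √(Real.log n) := Real.le_sqrt_of_sq_le hlog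
    have hrsq : √(Real.log n) ^ 2 = Real.log n := Real.sq_sqrt hlog0
    set r := √(Real.log n) with hrdef
    have hr1 : 1 ≤ r := hR1.trans hr
    have hkey : Real.log C + 4 * s * r ≤ ε * Real.log n := by
      have h1 : |Real.log C| + 4 * s ≤ ε * r := by
        have := (div_le_iff₀ hε).1 (hR2.trans hr)
        linarith
      have h2 := le_abs_self (Real.log C)
      have h3 := abs_nonneg (Real.log C)
      have h4 : (|Real.log C| + 4 * s) * r ≤ ε * r * r :=
        mul_le_mul_of_nonneg_right h1 (by linarith)
      rw [← hrsq]
      nlinarith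
    have hlow := fsk_lower s k n hs hk hsn
    rw [← hC, ← hrdef] at hlow
    have hfin : (n : ℝ) ^ ((2 : ℝ) - ε) * C ≤ (n : ℝ) ^ 2 * Real.exp (-(4 * s * r)) := by
      have e1 : (n : ℝ) ^ ((2 : ℝ) - ε) = (n : ℝ) ^ 2 * Real.exp (-(ε * Real.log n)) := by
        rw [sub_eq_add_neg, Real.rpow_add hn0, Real.rpow_two, Real.rpow_def_of_pos hn0 (-ε)]
        congr 2
        ring
      rw [e1, mul_assoc]
      apply mul_le_mul_of_nonneg_left _ (by positivity)
      nth_rewrite 1 [← Real.exp_log hCpos]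
      rw [← Real.exp_add]
      apply Real.exp_le_exp.2
      linarith
    exact le_of_mul_le_mul_right (hfin.trans hlow) hCpos
  · have h1 : (fsk s k n : ℝ) ≤ (n : ℝ) ^ 2 := by exact_mod_cast fsk_le s k n hs
    refine h1.trans ?_
    rw [← Real.rpow_two]
    exact Real.rpow_le_rpow_of_exponent_le hn1 (by linarith)
end

section
/- There exists an absolute constant C > 0 such that for all integers k > s ≥ 3 and every sufficiently large integer n, f_{s,k}(n) ≤ (r_k(n)/n)^C · n². -/
open Finset Pointwise

theorem ap_count (s : ℕ) (hs : 3 ≤ s) (A : Finset ℤ) :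
    ∃ E : Finset (ℤ × ℤ), E ⊆ A ×ˢ A ∧ fAP s A ≤ E.card ∧ 2 * E.card ≤ A.card ^ 2 ∧
      (∀ e ∈ E, e.1 + e.2 ∈ A.image (fun x => 2 * x)) := by
  classical
  let E := (A ×ˢ A).filter (fun e => e.1 < e.2 ∧ e.1 + e.2 ∈ A.image (fun x => 2 * x))
  refine ⟨E, Finset.filter_subset _ _, ?_, ?_, ?_⟩
  · have hsub : {P : Finset ℤ | P ⊆ A ∧ ∃ x d : ℤ, d ≠ 0 ∧ P = AP s x d} ⊆
        ↑(E.image (fun e => AP s e.1 ((e.2 - e.1) / 2))) := by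
      rintro P ⟨hPA, x, d, hd, rfl⟩
      have key : ∃ y e : ℤ, 0 < e ∧ AP s x d = AP s y e := by
        rcases lt_or_gt_of_ne hd with h | h
        · refine ⟨x + (s - 1 : ℕ) * d, -d, by omega, ?_⟩
          unfold AP
          ext z
          simp only [Finset.mem_image, Finset.mem_range]
          constructor
          · rintro ⟨i, hi, rfl⟩
            refine ⟨s - 1 - i, by omega, ?_⟩
            rw [Nat.cast_sub (by omega : i ≤ s - 1)]
            ring
          · rintro ⟨i, hi, rfl⟩
            refine ⟨s - 1 - i, by omega, ?_⟩
            rw [Nat.cast_sub (by omega : i ≤ s - 1)]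
            ring
        · exact ⟨x, d, h, rfl⟩
      obtain ⟨y, e, he, heq⟩ := key
      rw [heq] at hPA ⊢
      have hm : ∀ i : ℕ, i < s → y + (i : ℤ) * e ∈ A := fun i hi =>
        hPA (Finset.mem_image_of_mem (fun i : ℕ => y + (i : ℤ) * e) (Finset.mem_range.2 hi))
      have h0 := hm 0 (by omega)
      have h1 := hm 1 (by omega)
      have h2 := hm 2 (by omega)
      simp only [Finset.coe_image, Set.mem_image, Finset.mem_coe]
      refine ⟨(y, y + 2 * e), ?_, ?_⟩
      · simp only [E, Finset.mem_filter, Finset.mem_product, Finset.mem_image]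
        refine ⟨⟨by simpa using h0, by simpa using h2⟩, by omega, y + e, by simpa using h1, by ring⟩
      · simp
    unfold fAP
    calc _ = Set.ncard {P : Finset ℤ | P ⊆ A ∧ ∃ x d : ℤ, d ≠ 0 ∧ P = AP s x d} := rfl
      _ ≤ Set.ncard (↑(E.image (fun e => AP s e.1 ((e.2 - e.1) / 2))) : Set (Finset ℤ)) :=
        Set.ncard_le_ncard hsub (Finset.finite_toSet _)
      _ ≤ _ := by
        rw [Set.ncard_coe_finset]
        exact Finset.card_image_le
  · have hd : Disjoint E (E.map (Equiv.prodComm ℤ ℤ).toEmbedding) := by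
      rw [Finset.disjoint_left]
      intro p hp hq
      simp only [E, Finset.mem_map, Finset.mem_filter] at hp hq
      obtain ⟨q, hq, rfl⟩ := hq
      have := hp.2.1
      have := hq.2.1
      simp at *
      omega
    have hu : E ∪ (E.map (Equiv.prodComm ℤ ℤ).toEmbedding) ⊆ A ×ˢ A := by
      intro p hp
      simp only [E, Finset.mem_union, Finset.mem_map, Finset.mem_filter, Finset.mem_product] at hp ⊢
      rcases hp with h | ⟨q, hq, rfl⟩
      · exact h.1
      · exact ⟨hq.1.2, hq.1.1⟩
    have := Finset.card_le_card hu
    rw [Finset.card_union_of_disjoint hd, Finset.card_map, Finset.card_product] at this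
    nlinarith
  · intro e he
    exact (Finset.mem_filter.1 he).2.2

theorem bsg_choice (A : Finset ℤ) (E : Finset (ℤ × ℤ)) (hE : E ⊆ A ×ˢ A) (n δ : ℝ)
    (hn : (A.card : ℝ) = n) (hn0 : 0 < n) (hδ : 0 < δ) (he : (E.card : ℝ) = δ * n ^ 2)
    (X : ℤ → ℤ → Finset ℤ) (hX : ∀ a a', X a a' = A.filter (fun b => (a, b) ∈ E ∧ (a', b) ∈ E)) :
    ∃ U ⊆ A, δ ^ 2 * n ^ 2 / 2 ≤ (U.card : ℝ) ^ 2 ∧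
      16 * (((U ×ˢ U).filter (fun p => ((X p.1 p.2).card : ℝ) < δ ^ 2 / 32 * n)).card : ℝ)
        ≤ (U.card : ℝ) ^ 2 := by
  classical
  let N : ℤ → Finset ℤ := fun b => A.filter (fun a => (a, b) ∈ E)
  let Bd : Finset (ℤ × ℤ) := (A ×ˢ A).filter (fun p => ((X p.1 p.2).card : ℝ) < δ ^ 2 / 32 * n)
  let bd : ℤ → Finset (ℤ × ℤ) := fun b =>
    (N b ×ˢ N b).filter (fun p => ((X p.1 p.2).card : ℝ) < δ ^ 2 / 32 * n)
  have hA : A.Nonempty := by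
    rw [← Finset.card_pos]
    have : (0:ℝ) < A.card := by rw [hn]; exact hn0
    exact_mod_cast this
  have h1 : (∑ b ∈ A, ((N b).card : ℝ)) = δ * n ^ 2 := by
    rw [← he]
    have hm : Set.MapsTo (fun e : ℤ × ℤ => e.2) (E : Set (ℤ × ℤ)) (A : Set ℤ) := by
      intro e h
      exact (Finset.mem_product.1 (hE h)).2
    rw [Finset.card_eq_sum_card_fiberwise hm]
    push_cast
    refine Finset.sum_congr rfl fun b _ => ?_
    congr 1
    refine Finset.card_bij' (fun a _ => (a, b)) (fun e _ => e.1) ?_ ?_ ?_ ?_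
    · intro a ha
      exact Finset.mem_filter.2 ⟨(Finset.mem_filter.1 ha).2, rfl⟩
    · intro e h
      obtain ⟨h', rfl⟩ := Finset.mem_filter.1 h
      exact Finset.mem_filter.2 ⟨(Finset.mem_product.1 (hE h')).1, h'⟩
    · intro a ha; rfl
    · intro e h
      obtain ⟨h, rfl⟩ := Finset.mem_filter.1 h
      rfl
  have h2 : δ ^ 2 * n ^ 3 ≤ ∑ b ∈ A, ((N b).card : ℝ) ^ 2 := by
    have := sq_sum_le_card_mul_sum_sq (s := A) (f := fun b => ((N b).card : ℝ))
    rw [h1, hn] at this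
    have h : n * (δ ^ 2 * n ^ 3) ≤ n * ∑ b ∈ A, ((N b).card : ℝ) ^ 2 := by
      refine le_trans (le_of_eq ?_) this; ring
    exact le_of_mul_le_mul_left h hn0
  have h3 : (∑ b ∈ A, ((bd b).card : ℝ)) ≤ δ ^ 2 * n ^ 3 / 32 := by
    have e1 : ∑ b ∈ A, (bd b).card = ∑ p ∈ Bd, (X p.1 p.2).card := by
      have := Finset.sum_card_bipartiteAbove_eq_sum_card_bipartiteBelow
        (fun (b : ℤ) (p : ℤ × ℤ) => (p.1, b) ∈ E ∧ (p.2, b) ∈ E) (s := A) (t := Bd)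
      convert this using 1
      · refine Finset.sum_congr rfl fun b _ => ?_
        congr 1
        ext p
        simp only [bd, Bd, N, Finset.bipartiteAbove, Finset.mem_filter, Finset.mem_product]
        tauto
      · refine Finset.sum_congr rfl fun p _ => ?_
        rw [hX]; rfl
    have e2 : (∑ b ∈ A, ((bd b).card : ℝ)) = ∑ p ∈ Bd, ((X p.1 p.2).card : ℝ) := by
      exact_mod_cast e1
    rw [e2]
    have e3 : ∑ p ∈ Bd, ((X p.1 p.2).card : ℝ) ≤ ∑ p ∈ Bd, (δ ^ 2 / 32 * n) :=
      Finset.sum_le_sum fun p hp => (Finset.mem_filter.1 hp).2.le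
    rw [Finset.sum_const, nsmul_eq_mul] at e3
    have e4 : (Bd.card : ℝ) ≤ n ^ 2 := by
      have : Bd.card ≤ A.card * A.card := by
        rw [← Finset.card_product]; exact Finset.card_le_card (Finset.filter_subset _ _)
      rw [← hn, sq]; exact_mod_cast this
    refine e3.trans ((mul_le_mul_of_nonneg_right e4 (by positivity)).trans (le_of_eq ?_))
    ring
  obtain ⟨b, hb, hle⟩ := Finset.exists_le_of_sum_le (s := A) (f := fun _ => δ ^ 2 * n ^ 2 / 2)
    (g := fun b => ((N b).card : ℝ) ^ 2 - 16 * ((bd b).card : ℝ)) hA (by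
      rw [Finset.sum_const, nsmul_eq_mul, Finset.sum_sub_distrib, ← Finset.mul_sum, hn]
      have : n * (δ ^ 2 * n ^ 2 / 2) = δ ^ 2 * n ^ 3 - 16 * (δ ^ 2 * n ^ 3 / 32) := by ring
      rw [this]
      linarith)
  refine ⟨N b, Finset.filter_subset _ _, ?_, ?_⟩
  · have : (0:ℝ) ≤ ((bd b).card : ℝ) := by positivity
    linarith
  · have : 0 ≤ δ ^ 2 * n ^ 2 / 2 := by positivity
    change 16 * ((bd b).card : ℝ) ≤ _
    linarith

theorem bsg (A : Finset ℤ) (E : Finset (ℤ × ℤ)) (S : Finset ℤ) (hE : E ⊆ A ×ˢ A) (n δ : ℝ)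
    (hn : (A.card : ℝ) = n) (hn0 : 0 < n) (hδ : 0 < δ) (he : (E.card : ℝ) = δ * n ^ 2)
    (hS : ∀ e ∈ E, e.1 + e.2 ∈ S) (hSn : (S.card : ℝ) ≤ n) :
    ∃ B ⊆ A, δ * n / 2 ≤ (B.card : ℝ) ∧ ((B - B).card : ℝ) * (δ ^ 5 / 2 ^ 12) ≤ n := by
  classical
  let X : ℤ → ℤ → Finset ℤ := fun a a' => A.filter (fun b => (a, b) ∈ E ∧ (a', b) ∈ E)
  obtain ⟨U, hUA, hU1, hU2⟩ := bsg_choice A E hE n δ hn hn0 hδ he X (fun _ _ => rfl)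
  set τ : ℝ := δ ^ 2 / 32 * n with hτ
  have hτ0 : 0 < τ := by positivity
  let P : ℤ → ℤ → Prop := fun a a' => ((X a a').card : ℝ) < τ
  have hXs : ∀ a a', X a a' = X a' a := by
    intro a a'; simp only [X]; congr 1; ext b; tauto
  let B := U.filter (fun a => 4 * ((U.filter (fun a' => P a a')).card : ℝ) ≤ U.card)
  set u : ℝ := (U.card : ℝ) with hu
  have hδn : 0 < δ * n := by positivity
  have hu0 : 2 / 3 * (δ * n) ≤ u := by
    have : 0 ≤ u := by positivity
    by_contra! h
    nlinarith
  have hupos : 0 < u := by linarith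
  have hB : 3 / 4 * u ≤ (B.card : ℝ) := by
    let W := U.filter (fun a => ¬ 4 * ((U.filter (fun a' => P a a')).card : ℝ) ≤ U.card)
    have hc : B.card + W.card = U.card := Finset.card_filter_add_card_filter_not _
    have hc' : (B.card : ℝ) + W.card = u := by rw [hu]; exact_mod_cast hc
    have hsum : ∑ a ∈ W, ((U.filter (fun a' => P a a')).card : ℝ) ≤
        (((U ×ˢ U).filter (fun p => ((X p.1 p.2).card : ℝ) < τ)).card : ℝ) := by
      have : (W.sigma (fun a => U.filter (fun a' => P a a'))).card ≤
          ((U ×ˢ U).filter (fun p => ((X p.1 p.2).card : ℝ) < τ)).card := by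
        refine Finset.card_le_card_of_injOn (fun x => (x.1, x.2)) ?_ ?_
        · rintro ⟨a, a'⟩ h
          have h := Finset.mem_sigma.1 h
          have h' := Finset.mem_filter.1 h.2
          exact Finset.mem_filter.2 ⟨Finset.mem_product.2 ⟨(Finset.mem_filter.1 h.1).1, h'.1⟩, h'.2⟩
        · rintro ⟨a, a'⟩ _ ⟨c, c'⟩ _ h
          simp only [Prod.mk.injEq] at h
          obtain ⟨rfl, rfl⟩ := h
          rfl
      rw [Finset.card_sigma] at this
      exact_mod_cast this
    have hlow : (W.card : ℝ) * (u / 4) ≤ ∑ a ∈ W, ((U.filter (fun a' => P a a')).card : ℝ) := by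
      rw [← nsmul_eq_mul]
      refine Finset.card_nsmul_le_sum _ _ _ fun a ha => ?_
      have := (Finset.mem_filter.1 ha).2
      push Not at this
      linarith
    have : 4 * (W.card : ℝ) * u ≤ u * u := by nlinarith
    have := le_of_mul_le_mul_right this hupos
    linarith
  refine ⟨B, (Finset.filter_subset _ _).trans hUA, by linarith, ?_⟩
  -- counting
  have hfib : ∀ d ∈ B - B, u / 2 * τ ^ 2 ≤
      (((S ×ˢ S ×ˢ S ×ˢ S).filter (fun q => q.1 - q.2.1 + q.2.2.1 - q.2.2.2 = d)).card : ℝ) := by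
    intro d hd
    obtain ⟨a, ha, a', ha', rfl⟩ := Finset.mem_sub.1 hd
    let G := U.filter (fun c => ¬ P a c ∧ ¬ P a' c)
    have hG : u / 2 ≤ (G.card : ℝ) := by
      have h1 := (Finset.mem_filter.1 ha).2
      have h2 := (Finset.mem_filter.1 ha').2
      have : U ⊆ G ∪ (U.filter (fun c => P a c) ∪ U.filter (fun c => P a' c)) := by
        intro c hc
        simp only [G, Finset.mem_union, Finset.mem_filter]
        tauto
      have h3 := (Finset.card_le_card this).trans (Finset.card_union_le _ _)
      have h4 := Finset.card_union_le (U.filter (fun c => P a c)) (U.filter (fun c => P a' c))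
      have h5 : (U.card : ℝ) ≤ G.card + ((U.filter (fun c => P a c)).card +
        (U.filter (fun c => P a' c)).card) := by exact_mod_cast h3.trans (by omega)
      linarith
    have hle : (G.sigma (fun c => X a c ×ˢ X a' c)).card ≤
        ((S ×ˢ S ×ˢ S ×ˢ S).filter (fun q => q.1 - q.2.1 + q.2.2.1 - q.2.2.2 = a - a')).card := by
      refine Finset.card_le_card_of_injOn
        (fun x => (a + x.2.1, x.1 + x.2.1, x.1 + x.2.2, a' + x.2.2)) ?_ ?_
      · rintro ⟨c, b, b'⟩ h
        simp only [Finset.mem_coe, Finset.mem_sigma, Finset.mem_product, X, Finset.mem_filter] at h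
        obtain ⟨-, ⟨-, h1, h2⟩, -, h3, h4⟩ := h
        simp only [Finset.mem_coe, Finset.mem_filter, Finset.mem_product]
        exact ⟨⟨hS _ h1, hS _ h2, hS _ h4, hS _ h3⟩, by ring⟩
      · rintro ⟨c, b, b'⟩ _ ⟨c2, b2, b2'⟩ _ h
        simp only [Prod.mk.injEq] at h
        obtain ⟨h1, h2, h3, h4⟩ := h
        obtain rfl : b = b2 := by omega
        obtain rfl : b' = b2' := by omega
        obtain rfl : c = c2 := by omega
        rfl
    rw [Finset.card_sigma] at hle
    have hle' : ∑ c ∈ G, ((X a c).card : ℝ) * (X a' c).card ≤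
      (((S ×ˢ S ×ˢ S ×ˢ S).filter (fun q => q.1 - q.2.1 + q.2.2.1 - q.2.2.2 = a - a')).card : ℝ) := by
      simp only [Finset.card_product] at hle
      exact_mod_cast hle
    refine le_trans ?_ hle'
    calc u / 2 * τ ^ 2 ≤ (G.card : ℝ) * τ ^ 2 := by gcongr
      _ ≤ _ := by
        rw [← nsmul_eq_mul]
        refine Finset.card_nsmul_le_sum _ _ _ fun c hc => ?_
        have := (Finset.mem_filter.1 hc).2
        simp only [P, not_lt] at this
        rw [sq]
        exact mul_le_mul this.1 this.2 hτ0.le (by positivity)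
  have htot : ∑ d ∈ B - B, (((S ×ˢ S ×ˢ S ×ˢ S).filter
      (fun q => q.1 - q.2.1 + q.2.2.1 - q.2.2.2 = d)).card : ℝ) ≤ n ^ 4 := by
    have h1 := Finset.sum_card_fiberwise_eq_card_filter (S ×ˢ S ×ˢ S ×ˢ S) (B - B)
      (fun q => q.1 - q.2.1 + q.2.2.1 - q.2.2.2)
    have h2 : ∑ d ∈ B - B, ((S ×ˢ S ×ˢ S ×ˢ S).filter
      (fun q => q.1 - q.2.1 + q.2.2.1 - q.2.2.2 = d)).card ≤ S.card ^ 4 := by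
      rw [h1]
      refine (Finset.card_le_card (Finset.filter_subset _ _)).trans (le_of_eq ?_)
      simp only [Finset.card_product]; ring
    calc _ ≤ ((S.card : ℝ)) ^ 4 := by exact_mod_cast h2
      _ ≤ _ := by gcongr
  have hlow : ((B - B).card : ℝ) * (u / 2 * τ ^ 2) ≤ n ^ 4 := by
    refine le_trans ?_ htot
    rw [← nsmul_eq_mul]
    exact Finset.card_nsmul_le_sum _ _ _ hfib
  have h6 : n ^ 3 * (δ ^ 5 / 2 ^ 12) ≤ u / 2 * τ ^ 2 := by
    have : n ^ 3 * (δ ^ 5 / 2 ^ 12) = (δ * n / 4) * τ ^ 2 := by rw [hτ]; ring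
    rw [this]
    exact mul_le_mul_of_nonneg_right (by linarith) (by positivity)
  have h7 : n ^ 3 * (((B - B).card : ℝ) * (δ ^ 5 / 2 ^ 12)) ≤ n ^ 3 * n := by
    calc _ = ((B - B).card : ℝ) * (n ^ 3 * (δ ^ 5 / 2 ^ 12)) := by ring
      _ ≤ ((B - B).card : ℝ) * (u / 2 * τ ^ 2) := by gcongr
      _ ≤ n ^ 4 := hlow
      _ = _ := by ring
  exact le_of_mul_le_mul_left h7 (by positivity)

theorem embed (B : Finset ℤ) (N M : ℕ) (hM : ((2 • B - 2 • B).card) ≤ M) (hM0 : 0 < M) (hN : N = 8 * M) :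
    ∃ φ : ℤ → ℤ, (∀ x, 0 ≤ φ x ∧ φ x < N) ∧
      (∀ a ∈ B, ∀ b ∈ B, φ a = φ b → a = b) ∧
      (∀ a ∈ B, ∀ b ∈ B, ∀ c ∈ B, φ a + φ c = 2 * φ b → a + c = 2 * b) := by
  classical
  set T := (2 • B - 2 • B).erase 0 with hT
  have hTM : T.card ≤ M := (Finset.card_le_card (Finset.erase_subset _ _)).trans hM
  -- large prime
  obtain ⟨p, hpge, hp⟩ := Nat.exists_infinite_primes ((∑ t ∈ T, t.natAbs) + 3 + N)
  have := Fact.mk hp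
  have hNpos : 0 < N := by omega
  have hTp : ∀ t ∈ T, (t : ZMod p) ≠ 0 := by
    intro t ht h
    rw [ZMod.intCast_zmod_eq_zero_iff_dvd] at h
    have h1 : t ≠ 0 := Finset.ne_of_mem_erase ht
    have h2 : t.natAbs ≤ ∑ t ∈ T, t.natAbs :=
      Finset.single_le_sum (f := fun t : ℤ => t.natAbs) (fun _ _ => Nat.zero_le _) ht
    have h3 := Int.natAbs_dvd_natAbs.2 h
    simp only [Int.natAbs_natCast] at h3
    have := Nat.le_of_dvd (Int.natAbs_pos.2 h1) h3
    omega
  -- bad multipliers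
  let m := 2 * p / N
  let J : Finset ℤ := (Finset.Icc (-(m:ℤ)) m).erase 0
  have hJ : J.card ≤ 2 * m := by
    have : (0:ℤ) ∈ Finset.Icc (-(m:ℤ)) m := by simp
    rw [Finset.card_erase_of_mem this, Int.card_Icc]
    omega
  let bad : Finset (ZMod p) := insert 0 ((T ×ˢ J).image (fun x => ((x.2 * N : ℤ) : ZMod p) * ((x.1 : ℤ) : ZMod p)⁻¹))
  have hbad : bad.card < p := by
    have h1 : bad.card ≤ (T ×ˢ J).card + 1 :=
      (Finset.card_insert_le _ _).trans (Nat.add_le_add_right Finset.card_image_le _)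
    rw [Finset.card_product] at h1
    have h2 : T.card * J.card ≤ M * (2 * m) := Nat.mul_le_mul hTM hJ
    have h3 : m * N ≤ 2 * p := Nat.div_mul_le_self _ _
    have h4 : 8 * (m * M) ≤ 2 * p := by rw [hN] at h3; linarith
    have h5 : M * (2 * m) = 2 * (m * M) := by ring
    omega
  obtain ⟨q, hq⟩ : ∃ q : ZMod p, q ∉ bad := by
    by_contra! h
    have : bad = Finset.univ := Finset.eq_univ_iff_forall.2 h
    rw [this, Finset.card_univ, ZMod.card] at hbad
    omega
  let g : ℤ → ℤ := fun x => ((q * (x : ZMod p)).val : ℤ)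
  have hg : ∀ x, ((g x : ℤ) : ZMod p) = q * x := by
    intro x
    simp [g]
  have hg0 : ∀ x, 0 ≤ g x ∧ g x < p := by
    intro x
    exact ⟨Int.natCast_nonneg _, Int.ofNat_lt.2 (ZMod.val_lt _)⟩
  -- main claim
  have main : ∀ t ∈ 2 • B - 2 • B, ∀ w : ℤ, (w : ZMod p) = q * t → -(2 * p) < w → w < 2 * p →
      (N : ℤ) ∣ w → t = 0 := by
    intro t ht w hw hw1 hw2 ⟨j, hj⟩
    by_contra ht0
    have htT : t ∈ T := Finset.mem_erase.2 ⟨ht0, ht⟩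
    have hne := hTp t htT
    apply hq
    by_cases hj0 : j = 0
    · subst hj0
      rw [mul_zero] at hj
      subst hj
      have : q = 0 := by
        have h : q * (t : ZMod p) = 0 := by rw [← hw]; simp
        exact (mul_eq_zero.1 h).resolve_right hne
      rw [this]
      exact Finset.mem_insert_self _ _
    · refine Finset.mem_insert_of_mem (Finset.mem_image.2 ⟨(t, j), ?_, ?_⟩)
      · refine Finset.mem_product.2 ⟨htT, Finset.mem_erase.2 ⟨hj0, ?_⟩⟩
        have hNz : (0:ℤ) < N := by exact_mod_cast hNpos
        have hm : (m : ℤ) = (2 * p) / N := by simp [m]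
        rw [Finset.mem_Icc, hm]
        constructor
        · have : -j ≤ (2 * p : ℤ) / N := by
            rw [Int.le_ediv_iff_mul_le hNz]; nlinarith
          simp only; omega
        · simp only
          rw [Int.le_ediv_iff_mul_le hNz]; nlinarith
      · have : ((j * N : ℤ) : ZMod p) = q * t := by rw [← hw, hj, mul_comm]
        simp only
        rw [this, mul_assoc, mul_inv_cancel₀ hne, mul_one]
  have hmem : ∀ a ∈ B, ∀ b ∈ B, ∀ c ∈ B, ∀ d ∈ B, a + b - (c + d) ∈ 2 • B - 2 • B := by
    intro a ha b hb c hc d hd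
    rw [two_nsmul]
    exact Finset.sub_mem_sub (Finset.add_mem_add ha hb) (Finset.add_mem_add hc hd)
  have hNz : (N : ℤ) ≠ 0 := by exact_mod_cast hNpos.ne'
  refine ⟨fun x => g x % N, ?_, ?_, ?_⟩
  · intro x
    exact ⟨Int.emod_nonneg _ hNz, Int.emod_lt_of_pos _ (by exact_mod_cast hNpos)⟩
  · intro a ha b hb hab
    have := main (a + a - (a + b)) (hmem a ha a ha a ha b hb) (g a - g b)
      (by push_cast; rw [hg, hg]; ring) (by have := hg0 a; have := hg0 b; omega)
      (by have := hg0 a; have := hg0 b; omega) (Int.ModEq.dvd (by exact hab.symm))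
    omega
  · intro a ha b hb c hc habc
    have hdv : (N : ℤ) ∣ g a + g c - (g b + g b) := by
      have h1 := Int.emod_add_mul_ediv (g a) N
      have h2 := Int.emod_add_mul_ediv (g b) N
      have h3 := Int.emod_add_mul_ediv (g c) N
      refine ⟨g a / N + g c / N - 2 * (g b / N), ?_⟩
      simp only at habc
      linear_combination habc - h1 - h3 + 2 * h2
    have := main (a + c - (b + b)) (hmem a ha c hc b hb b hb) (g a + g c - (g b + g b))
      (by push_cast; rw [hg, hg, hg]; ring)
      (by have := hg0 a; have := hg0 b; have := hg0 c; omega)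
      (by have := hg0 a; have := hg0 b; have := hg0 c; omega) hdv
    omega

theorem rk_lower (k : ℕ) (hk : 3 ≤ k) (n : ℕ) (hn : 0 < n) (B : Finset ℤ) (hB : APFree k ↑B)
    (L M : ℕ) (hM0 : 0 < M)
    (hM : ((2 • B - 2 • B).card) ≤ M) (hL : 8 * M ≤ L * n) : B.card ≤ L * rk k n := by
  classical
  obtain ⟨φ, h1, h2, h3⟩ := embed B (8 * M) M hM hM0 rfl
  -- each class is small
  have hcls : ∀ j ∈ Finset.range L, (B.filter (fun b => φ b / n = (j : ℤ))).card ≤ rk k n := by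
    intro j _
    set Bj := B.filter (fun b => φ b / n = (j : ℤ)) with hBj
    have hnz : (0:ℤ) < n := by exact_mod_cast hn
    have hinj : Set.InjOn (fun b => φ b - j * n + 1) (Bj : Set ℤ) := by
      intro a ha b hb hab
      simp only [hBj, Finset.coe_filter, Set.mem_ofPred_eq] at ha hb
      exact h2 a ha.1 b hb.1 (by simp only at hab; omega)
    rw [← Finset.card_image_of_injOn hinj]
    refine le_csSup ⟨n, ?_⟩ ⟨_, ?_, ?_, rfl⟩
    · rintro m ⟨A, hA, -, rfl⟩
      have := Finset.card_le_card hA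
      simpa using this
    · intro y hy
      obtain ⟨b, hb, rfl⟩ := Finset.mem_image.1 hy
      have hb' := (Finset.mem_filter.1 hb).2
      have := Int.emod_add_mul_ediv (φ b) n
      have h5 := Int.emod_nonneg (φ b) hnz.ne'
      have h6 := Int.emod_lt_of_pos (φ b) hnz
      rw [hb'] at this
      rw [Finset.mem_Icc]
      constructor <;> nlinarith
    · intro x d hd hsub
      have hpre : ∀ i : ℕ, ∃ b : ℤ, i < k → b ∈ B ∧ φ b - j * n + 1 = x + i * d := by
        intro i
        by_cases hi : i < k
        · have : x + (i : ℤ) * d ∈ AP k x d :=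
            Finset.mem_image_of_mem (fun i : ℕ => x + (i : ℤ) * d) (Finset.mem_range.2 hi)
          have := hsub this
          simp only [Finset.coe_image, Set.mem_image, Finset.mem_coe] at this
          obtain ⟨b, hb, hb2⟩ := this
          exact ⟨b, fun _ => ⟨(Finset.mem_filter.1 hb).1, hb2⟩⟩
        · exact ⟨0, fun h => absurd h hi⟩
      choose b hb using hpre
      have hstep : ∀ i : ℕ, i + 2 < k → b i + b (i + 2) = 2 * b (i + 1) := by
        intro i hi
        obtain ⟨ha, ha'⟩ := hb i (by omega)
        obtain ⟨hb1, hb'⟩ := hb (i + 1) (by omega)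
        obtain ⟨hc, hc'⟩ := hb (i + 2) (by omega)
        refine h3 _ ha _ hb1 _ hc ?_
        push_cast at hb' hc'
        linear_combination ha' + hc' - 2 * hb'
      have hlin : ∀ i : ℕ, i < k → (b i = b 0 + i * (b 1 - b 0)) := by
        intro i
        induction i using Nat.strong_induction_on with
        | _ i ih =>
          intro hi
          match i, ih, hi with
          | 0, _, _ => simp
          | 1, _, _ => simp
          | i + 2, ih, hi =>
            have e1 := ih i (by omega) (by omega)
            have e2 := ih (i + 1) (by omega) (by omega)
            have e3 := hstep i hi
            push_cast at e2 ⊢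
            linear_combination e3 - e1 + 2 * e2
      refine hB (b 0) (b 1 - b 0) ?_ ?_
      · intro h
        have e0 := (hb 0 (by omega)).2
        have e1 := (hb 1 (by omega)).2
        have : b 1 = b 0 := by omega
        rw [this] at e1
        apply hd
        push_cast at e0 e1
        linarith
      · intro y hy
        obtain ⟨i, hi, rfl⟩ := Finset.mem_image.1 hy
        rw [Finset.mem_range] at hi
        rw [← hlin i hi]
        exact (hb i hi).1
  have hmap : ∀ b ∈ B, φ b / n ∈ (Finset.range L).image (fun j : ℕ => (j : ℤ)) := by
    intro b _
    have hnz : (0:ℤ) < n := by exact_mod_cast hn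
    have h4 : 0 ≤ φ b / n := Int.ediv_nonneg (h1 b).1 hnz.le
    have h5 : φ b / n < L := by
      rw [Int.ediv_lt_iff_lt_mul hnz]
      refine (h1 b).2.trans_le ?_
      exact_mod_cast hL
    refine Finset.mem_image.2 ⟨(φ b / n).toNat, Finset.mem_range.2 (by omega), by omega⟩
  rw [Finset.card_eq_sum_card_fiberwise hmap, Finset.sum_image (by intro a _ b _ h; simpa using h)]
  refine (Finset.sum_le_sum hcls).trans ?_
  simp

theorem density_bound (k : ℕ) (hk : 3 ≤ k) (n : ℕ) (hn : 0 < n) (A : Finset ℤ)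
    (hA : A.card = n) (hfree : APFree k ↑A) (E : Finset (ℤ × ℤ)) (hE : E ⊆ A ×ˢ A)
    (hE2 : 2 * E.card ≤ A.card ^ 2) (hpos : 0 < E.card)
    (hsum : ∀ e ∈ E, e.1 + e.2 ∈ A.image (fun x => 2 * x)) :
    ((E.card : ℝ) / (n : ℝ) ^ 2) ^ 82 ≤ (rk k n : ℝ) / n := by
  classical
  have hnR : (0:ℝ) < n := by exact_mod_cast hn
  have heR : (0:ℝ) < E.card := by exact_mod_cast hpos
  set δ : ℝ := (E.card : ℝ) / (n : ℝ) ^ 2 with hδdef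
  have hδ : 0 < δ := by positivity
  have hδ2 : δ ≤ 1 / 2 := by
    rw [hδdef, div_le_iff₀ (by positivity)]
    rw [hA] at hE2
    have : (2:ℝ) * E.card ≤ (n:ℝ) ^ 2 := by exact_mod_cast hE2
    linarith
  obtain ⟨B, hBA, hB1, hB2⟩ := bsg A E (A.image (fun x => 2 * x)) hE n δ (by rw [hA]) hnR hδ
    (by rw [hδdef]; field_simp) hsum (by rw [← hA]; exact_mod_cast Finset.card_image_le)
  have hBpos : (0:ℝ) < B.card := lt_of_lt_of_le (by positivity) hB1
  have hBne : B.Nonempty := by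
    rw [← Finset.card_pos]; exact_mod_cast hBpos
  have hBn : (B.card : ℝ) ≤ n := by
    rw [← hA]; exact_mod_cast Finset.card_le_card hBA
  have hBfree : APFree k ↑B := fun x d hd h => hfree x d hd (h.trans (by exact_mod_cast hBA))
  set M := (2 • B - 2 • B).card with hMdef
  have hM0 : 0 < M := by
    rw [hMdef, Finset.card_pos, two_nsmul]
    exact (hBne.add hBne).sub (hBne.add hBne)
  have hPl : (M : ℝ) ≤ (((B - B).card : ℝ) / B.card) ^ 4 * B.card := by
    have := Finset.pluennecke_ruzsa_inequality_nsmul_sub_nsmul_sub hBne B 2 2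
    have h2 : (((2 • B - 2 • B).card : ℚ≥0) : ℝ) ≤
      (((((B - B).card : ℚ≥0) / (B.card : ℚ≥0)) ^ (2 + 2) * (B.card : ℚ≥0) : ℚ≥0) : ℝ) := by
      exact_mod_cast this
    push_cast at h2
    simpa using h2
  have hK : ((B - B).card : ℝ) / B.card ≤ 2 ^ 13 / δ ^ 6 := by
    rw [div_le_div_iff₀ hBpos (by positivity)]
    have h1 : ((B - B).card : ℝ) * δ ^ 5 ≤ 2 ^ 12 * n := by
      have : ((B - B).card : ℝ) * (δ ^ 5 / 2 ^ 12) = ((B - B).card : ℝ) * δ ^ 5 / 2 ^ 12 := by ring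
      rw [this, div_le_iff₀ (by positivity)] at hB2
      linarith
    calc ((B - B).card : ℝ) * δ ^ 6 = (((B - B).card : ℝ) * δ ^ 5) * δ := by ring
      _ ≤ (2 ^ 12 * n) * δ := by gcongr
      _ = 2 ^ 13 * (δ * n / 2) := by ring
      _ ≤ 2 ^ 13 * B.card := by gcongr
  have hM : (M : ℝ) ≤ 2 ^ 52 / δ ^ 24 * n := by
    calc (M : ℝ) ≤ (((B - B).card : ℝ) / B.card) ^ 4 * B.card := hPl
      _ ≤ (2 ^ 13 / δ ^ 6) ^ 4 * n := by gcongr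
      _ = 2 ^ 52 / δ ^ 24 * n := by rw [div_pow, ← pow_mul, ← pow_mul]
  set L := ⌈(8 * M : ℝ) / n⌉₊ with hL
  have hL1 : 8 * M ≤ L * n := by
    have := Nat.le_ceil ((8 * M : ℝ) / n)
    rw [div_le_iff₀ hnR, ← hL] at this
    exact_mod_cast this
  have hone : (1:ℝ) ≤ 1 / δ ^ 24 := by
    rw [le_div_iff₀ (by positivity), one_mul]
    exact pow_le_one₀ hδ.le (by linarith)
  have hL2 : (L : ℝ) ≤ 2 ^ 56 / δ ^ 24 := by
    have h1 : (L : ℝ) < (8 * M : ℝ) / n + 1 := Nat.ceil_lt_add_one (by positivity)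
    have h2 : (8 * M : ℝ) / n ≤ 8 * (2 ^ 52 / δ ^ 24) := by
      rw [div_le_iff₀ hnR]; linarith
    have e1 : (2:ℝ) ^ 52 / δ ^ 24 = 2 ^ 52 * (1 / δ ^ 24) := by ring
    have e2 : (2:ℝ) ^ 56 / δ ^ 24 = 2 ^ 56 * (1 / δ ^ 24) := by ring
    rw [e1] at h2
    rw [e2]
    linarith
  have hr := rk_lower k hk n hn B hBfree L M hM0 le_rfl hL1
  have hr' : (B.card : ℝ) ≤ L * rk k n := by exact_mod_cast hr
  have hfin : δ * n / 2 ≤ 2 ^ 56 / δ ^ 24 * rk k n :=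
    hB1.trans (hr'.trans (by gcongr))
  rw [div_mul_eq_mul_div (2 ^ 56) (δ ^ 24), le_div_iff₀ (by positivity)] at hfin
  rw [le_div_iff₀ hnR]
  have h57 : δ ^ 57 ≤ (1 / 2) ^ 57 := pow_le_pow_left₀ hδ.le hδ2 57
  calc δ ^ 82 * n = δ ^ 57 * (δ ^ 25 * n) := by ring
    _ ≤ (1 / 2) ^ 57 * (δ ^ 25 * n) := by gcongr
    _ = (1 / 2) ^ 56 * (δ * n / 2 * δ ^ 24) := by ring
    _ ≤ (1 / 2) ^ 56 * (2 ^ 56 * rk k n) := by gcongr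
    _ = rk k n := by rw [← mul_assoc]; norm_num

theorem fsk_upper_bound :
    ∃ C : ℝ, 0 < C ∧ ∀ k s : ℕ, 3 ≤ s → s < k →
      ∃ n₀ : ℕ, ∀ n : ℕ, n₀ ≤ n →
        (fsk s k n : ℝ) ≤ ((rk k n : ℝ) / n) ^ C * (n : ℝ) ^ 2 := by
  refine ⟨1 / 82, by norm_num, fun k s hs hsk => ⟨1, fun n hn => ?_⟩⟩
  have hnR : (0:ℝ) < n := by exact_mod_cast hn
  have hb0 : 0 ≤ ((rk k n : ℝ) / n) ^ (1 / 82 : ℝ) * (n : ℝ) ^ 2 := by positivity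
  suffices h : fsk s k n ≤ ⌊((rk k n : ℝ) / n) ^ (1 / 82 : ℝ) * (n : ℝ) ^ 2⌋₊ from
    (Nat.cast_le.2 h).trans (Nat.floor_le hb0)
  refine csSup_le' ?_
  rintro m ⟨A, hA, hfree, rfl⟩
  refine Nat.le_floor ?_
  obtain ⟨E, hE, hf, hE2, hsum⟩ := ap_count s hs A
  have hf' : (fAP s A : ℝ) ≤ E.card := by exact_mod_cast hf
  refine hf'.trans ?_
  rcases Nat.eq_zero_or_pos E.card with h0 | hpos
  · rw [h0]; simpa using hb0
  · have h := density_bound k (by omega) n hn A hA hfree E hE hE2 hpos hsum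
    have hδ : (0:ℝ) ≤ (E.card : ℝ) / (n : ℝ) ^ 2 := by positivity
    have h2 := Real.rpow_le_rpow (by positivity) h (by norm_num : (0:ℝ) ≤ 1 / 82)
    have h3 : (((E.card : ℝ) / (n : ℝ) ^ 2) ^ 82) ^ (1 / 82 : ℝ) = (E.card : ℝ) / (n : ℝ) ^ 2 := by
      have := Real.pow_rpow_inv_natCast hδ (by norm_num : (82:ℕ) ≠ 0)
      simpa using this
    rw [h3, div_le_iff₀ (by positivity)] at h2
    exact h2
end

section
/- There is an absolute constant c > 0 with the following property. Let k ≥ 4 be an integer, let A be a k-AP free set of n integers, and write the number of nontrivial three-term arithmetic progressions in A as p·n² where 0 < p < 1. Then for n sufficiently large, p²⁵ ≤ c · r_k(n)/n; equivalently, f_{3,k}(n) ≤ (c · r_k(n)/n)^{1/25} · n². -/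
open Finset Pointwise

def nbr (A : Finset ℤ) (E : Finset (ℤ × ℤ)) (v : ℤ) : Finset ℤ := A.filter (fun a => (a, v) ∈ E)

def codeg (A : Finset ℤ) (E : Finset (ℤ × ℤ)) (a a' : ℤ) : ℕ :=
  (A.filter (fun b => (a, b) ∈ E ∧ (a', b) ∈ E)).card

open Classical in
noncomputable def badPairs (A : Finset ℤ) (E : Finset (ℤ × ℤ)) (t : ℝ) (v : ℤ) : Finset (ℤ × ℤ) :=
  (nbr A E v ×ˢ nbr A E v).filter (fun x => (codeg A E x.1 x.2 : ℝ) < t)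

lemma sum_nbr (A : Finset ℤ) (E : Finset (ℤ × ℤ)) (hE : E ⊆ A ×ˢ A) :
    ∑ v ∈ A, (nbr A E v).card = E.card := by
  have h1 : E = (A ×ˢ A).filter (fun x => x ∈ E) := by
    ext x; simp only [mem_filter]
    exact ⟨fun h => ⟨hE h, h⟩, fun h => h.2⟩
  conv_rhs => rw [h1]
  simp only [nbr, card_filter]
  rw [sum_product_right]

lemma sum_bad (A : Finset ℤ) (E : Finset (ℤ × ℤ)) (t : ℝ) (ht : 0 ≤ t) :
    ∑ v ∈ A, ((badPairs A E t v).card : ℝ) ≤ (A.card : ℝ) ^ 2 * t := by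
  classical
  have h1 : ∀ v, badPairs A E t v = ((A ×ˢ A).filter
      (fun x => (codeg A E x.1 x.2 : ℝ) < t)).filter (fun x => (x.1, v) ∈ E ∧ (x.2, v) ∈ E) := by
    intro v; ext x
    simp only [badPairs, nbr, mem_filter, mem_product]
    tauto
  have h2 : ∀ v, ((badPairs A E t v).card : ℝ) = ∑ x ∈ (A ×ˢ A).filter
      (fun x => (codeg A E x.1 x.2 : ℝ) < t), if (x.1, v) ∈ E ∧ (x.2, v) ∈ E then (1 : ℝ) else 0 := by
    intro v
    rw [h1, card_filter]
    push_cast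
    rfl
  simp only [h2]
  rw [sum_comm]
  calc _ ≤ ∑ x ∈ (A ×ˢ A).filter (fun x => (codeg A E x.1 x.2 : ℝ) < t), t := by
        apply sum_le_sum
        intro x hx
        have := (mem_filter.1 hx).2
        simp only [codeg, card_filter] at this
        push_cast at this
        exact this.le
    _ ≤ ∑ x ∈ A ×ˢ A, t := by
        apply sum_le_sum_of_subset_of_nonneg (filter_subset _ _)
        intros; exact ht
    _ = _ := by rw [sum_const, card_product, nsmul_eq_mul]; push_cast; ring

lemma exists_vertex (A : Finset ℤ) (E : Finset (ℤ × ℤ)) (hE : E ⊆ A ×ˢ A) (p : ℝ) (hp : 0 < p)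
    (hA : 0 < A.card) (hpE : p * (A.card : ℝ) ^ 2 ≤ E.card) :
    ∃ v ∈ A, p ^ 2 * (A.card : ℝ) ^ 2 / 2 ≤ ((nbr A E v).card : ℝ) ^ 2
      - 16 * ((badPairs A E (p ^ 2 * A.card / 32) v).card : ℝ) := by
  have hn : (0 : ℝ) < A.card := by exact_mod_cast hA
  apply exists_le_of_sum_le (card_pos.1 hA)
  have h1 := sum_bad A E (p ^ 2 * A.card / 32) (by positivity)
  have h2 : (∑ v ∈ A, ((nbr A E v).card : ℝ)) = E.card := by exact_mod_cast sum_nbr A E hE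
  have h3 := sq_sum_le_card_mul_sum_sq (s := A) (f := fun v => ((nbr A E v).card : ℝ))
  rw [h2] at h3
  rw [sum_sub_distrib, ← mul_sum, sum_const, nsmul_eq_mul]
  have h4 : (p * (A.card : ℝ) ^ 2) ^ 2 ≤ (E.card : ℝ) ^ 2 := by gcongr
  have h5 : p ^ 2 * (A.card : ℝ) ^ 3 ≤ ∑ v ∈ A, ((nbr A E v).card : ℝ) ^ 2 := by
    refine le_of_mul_le_mul_left ?_ hn
    calc _ = (p * (A.card : ℝ) ^ 2) ^ 2 := by ring
      _ ≤ _ := h4.trans h3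
  nlinarith

lemma pathCount_eq (A : Finset ℤ) (E : Finset (ℤ × ℤ)) (a a' : ℤ) :
    pathCount A A E a a' = ∑ c ∈ A, codeg A E a c * codeg A E c a' := by
  simp only [pathCount, codeg, card_filter, sum_product]
  rw [sum_comm]
  refine sum_congr rfl fun c _ => ?_
  rw [sum_mul_sum]
  refine sum_congr rfl fun b _ => sum_congr rfl fun b' _ => ?_
  by_cases h1 : (a, b) ∈ E <;> by_cases h2 : (c, b) ∈ E <;> simp [h1, h2]

lemma bsg_graph (A : Finset ℤ) (E : Finset (ℤ × ℤ)) (hE : E ⊆ A ×ˢ A) (p : ℝ) (hp : 0 < p)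
    (hA : 0 < A.card) (hpE : p * (A.card : ℝ) ^ 2 ≤ E.card) :
    ∃ B ⊆ A, p * A.card / 2 ≤ (B.card : ℝ) ∧ ∀ a ∈ B, ∀ a' ∈ B,
      p ^ 5 * (A.card : ℝ) ^ 3 / 4096 ≤ (pathCount A A E a a' : ℝ) := by
  classical
  obtain ⟨v, hv, h⟩ := exists_vertex A E hE p hp hA hpE
  have hn : (0 : ℝ) < A.card := by exact_mod_cast hA
  set n : ℝ := (A.card : ℝ) with hndef
  set t : ℝ := p ^ 2 * n / 32 with ht
  set N := nbr A E v with hN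
  set W := badPairs A E t v with hW
  set s : ℝ := (N.card : ℝ) with hs
  have hs0 : 0 ≤ s := by positivity
  have hW0 : (0 : ℝ) ≤ W.card := by positivity
  have hsn : 2 / 3 * (p * n) ≤ s := by
    refine (abs_le_of_sq_le_sq' (a := 2 / 3 * (p * n)) ?_ hs0).2
    nlinarith [sq_nonneg (p * n)]
  have hspos : 0 < s := lt_of_lt_of_le (by positivity) hsn
  have hWs : 16 * (W.card : ℝ) ≤ s ^ 2 := by nlinarith [sq_nonneg (p * n)]
  have hNA : N ⊆ A := filter_subset _ _
  have symm : ∀ a b, codeg A E a b = codeg A E b a := by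
    intro a b; simp only [codeg, and_comm]
  let bad : ℤ → Finset ℤ := fun a => N.filter (fun c => (codeg A E a c : ℝ) < t)
  have hsumbad : ∑ a ∈ N, ((bad a).card : ℝ) = W.card := by
    simp only [bad, hW, badPairs, card_filter, sum_product, ← hN]
    push_cast; rfl
  let B := N.filter (fun a => ((bad a).card : ℝ) ≤ s / 4)
  refine ⟨B, (filter_subset _ _).trans hNA, ?_, ?_⟩
  · have h1 : ((N.filter (fun a => ¬ ((bad a).card : ℝ) ≤ s / 4)).card : ℝ) * (s / 4) ≤ W.card := by
      rw [← hsumbad, ← nsmul_eq_mul, ← sum_const]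
      calc _ ≤ ∑ a ∈ N.filter (fun a => ¬ ((bad a).card : ℝ) ≤ s / 4), ((bad a).card : ℝ) := by
            apply sum_le_sum
            intro a ha
            exact (not_le.1 (mem_filter.1 ha).2).le
        _ ≤ _ := sum_le_sum_of_subset_of_nonneg (filter_subset _ _) (by intros; positivity)
    have h2 : (B.card : ℝ) + ((N.filter (fun a => ¬ ((bad a).card : ℝ) ≤ s / 4)).card : ℝ) = s := by
      rw [hs]; exact_mod_cast card_filter_add_card_filter_not (s := N) _
    set x : ℝ := ((N.filter (fun a => ¬ ((bad a).card : ℝ) ≤ s / 4)).card : ℝ)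
    have h3 : x ≤ s / 4 := by
      have : x * s ≤ s / 4 * s := by nlinarith
      exact le_of_mul_le_mul_right this hspos
    linarith
  · intro a ha a' ha'
    have h1 : s / 2 ≤ ((N \ (bad a ∪ bad a')).card : ℝ) := by
      have e1 : (N.card : ℝ) ≤ (N \ (bad a ∪ bad a')).card + ((bad a).card + (bad a').card) := by
        have := card_le_card_sdiff_add_card (s := N) (t := bad a ∪ bad a')
        have := card_union_le (bad a) (bad a')
        norm_cast; omega
      have e2 := (mem_filter.1 ha).2
      have e3 := (mem_filter.1 ha').2
      linarith
    have ht0 : 0 ≤ t := by positivity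
    rw [pathCount_eq]
    push_cast
    calc p ^ 5 * n ^ 3 / 4096 ≤ s / 2 * (t * t) := by
          have : p ^ 5 * n ^ 3 / 4096 ≤ (2 / 3 * (p * n)) / 2 * (t * t) := by
            rw [ht]
            have : 0 ≤ p ^ 5 * n ^ 3 := by positivity
            nlinarith
          refine this.trans ?_
          gcongr
      _ ≤ ((N \ (bad a ∪ bad a')).card : ℝ) * (t * t) := by gcongr
      _ = ∑ c ∈ N \ (bad a ∪ bad a'), t * t := by simp
      _ ≤ ∑ c ∈ N \ (bad a ∪ bad a'), (codeg A E a c : ℝ) * codeg A E c a' := by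
          apply sum_le_sum
          intro c hc
          simp only [bad, mem_sdiff, mem_union, mem_filter, not_or, not_and, not_lt] at hc
          rw [symm c a']
          exact mul_le_mul (hc.2.1 hc.1) (hc.2.2 hc.1) ht0 (by positivity)
      _ ≤ _ := sum_le_sum_of_subset_of_nonneg (sdiff_subset.trans hNA) (by intros; positivity)

lemma subset_AP_iff (k : ℕ) (x d : ℤ) (S : Set ℤ) :
    (↑(AP k x d) : Set ℤ) ⊆ S ↔ ∀ i : ℕ, i < k → x + (i : ℤ) * d ∈ S := by
  simp only [AP, coe_image, Set.image_subset_iff]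
  constructor
  · intro h i hi
    exact h (by simpa using hi)
  · intro h i hi
    exact h i (by simpa using hi)

lemma APFree.mono {k : ℕ} {S T : Set ℤ} (h : S ⊆ T) (hT : APFree k T) : APFree k S :=
  fun x d hd hs => hT x d hd (hs.trans h)

lemma le_rk (k n : ℕ) (C : Finset ℤ) (hC : C ⊆ Finset.Icc 1 (n : ℤ)) (hf : APFree k ↑C) :
    C.card ≤ rk k n := by
  apply le_csSup
  · refine ⟨n, ?_⟩
    rintro m ⟨A, hA, -, rfl⟩
    simpa using card_le_card hA
  · exact ⟨C, hC, hf, rfl⟩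

/-- Cutting into intervals of length `n`. -/
lemma density_transfer (k n M : ℕ) (hn : 0 < n) (C : Finset ℤ) (hC : ∀ x ∈ C, 0 ≤ x ∧ x < M)
    (hf : APFree k ↑C) : C.card * n ≤ (M + n) * rk k n := by
  have h1 : C.card ≤ (M / n + 1) * rk k n := by
    have h2 : ∀ x ∈ C, (x / n).toNat ∈ Finset.range (M / n + 1) := by
      intro x hx
      obtain ⟨h0, h1⟩ := hC x hx
      lift x to ℕ using h0
      rw [mem_range]
      have : ((x : ℤ) / n).toNat = x / n := by norm_cast
      rw [this]
      have : x / n ≤ M / n := Nat.div_le_div_right (by omega)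
      omega
    rw [card_eq_sum_card_fiberwise h2]
    calc _ ≤ ∑ j ∈ Finset.range (M / n + 1), rk k n := ?_
      _ = _ := by simp
    apply sum_le_sum
    intro j hj
    set F := C.filter (fun x : ℤ => (x / n).toNat = j) with hF
    have hinj : Function.Injective (fun x : ℤ => x + (1 - j * n)) := add_left_injective _
    rw [← card_image_of_injective F hinj]
    apply le_rk
    · intro y hy
      obtain ⟨x, hx, rfl⟩ := mem_image.1 hy
      obtain ⟨hxC, hxj⟩ := mem_filter.1 hx
      obtain ⟨h0, -⟩ := hC x hxC
      have hq : 0 ≤ x / n := Int.ediv_nonneg h0 (by positivity)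
      have hq2 : x / n = j := by omega
      have h3 := Int.mul_ediv_add_emod x n
      have h4 := Int.emod_nonneg x (b := n) (by omega)
      have h5 := Int.emod_lt_of_pos x (b := n) (by omega)
      rw [hq2] at h3
      rw [mem_Icc]
      constructor <;> linarith
    · intro x d hd hs
      rw [subset_AP_iff] at hs
      apply hf (x - (1 - j * n)) d hd
      rw [subset_AP_iff]
      intro i hi
      obtain ⟨z, hz, hz2⟩ := mem_image.1 (mem_coe.1 (hs i hi))
      have : x - (1 - j * n) + i * d = z := by linarith
      rw [this]
      exact (mem_filter.1 hz).1
  calc C.card * n ≤ (M / n + 1) * rk k n * n := Nat.mul_le_mul_right _ h1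
    _ = (M / n * n + n) * rk k n := by ring
    _ ≤ _ := by gcongr; exact Nat.div_mul_le_self M n

/-- pulling back -/
lemma APFree_image (k : ℕ) (hk : 3 ≤ k) (B : Finset ℤ) (hB : APFree k ↑B) (φ : ℤ → ℤ)
    (h : ∀ x ∈ B, ∀ y ∈ B, ∀ z ∈ B, φ x + φ z = 2 * φ y → x + z = 2 * y) :
    APFree k ↑(B.image φ) := by
  intro x d hd hs
  rw [subset_AP_iff] at hs
  have : ∀ i : ℕ, ∃ b : ℤ, i < k → b ∈ B ∧ φ b = x + i * d := by
    intro i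
    by_cases hi : i < k
    · obtain ⟨b, hb, hb2⟩ := mem_image.1 (mem_coe.1 (hs i hi))
      exact ⟨b, fun _ => ⟨hb, hb2⟩⟩
    · exact ⟨0, fun h => absurd h hi⟩
  choose b hb using this
  have key : ∀ i : ℕ, i + 1 < k → b i = b 0 + i * (b 1 - b 0) ∧
      b (i + 1) = b 0 + ((i + 1 : ℕ) : ℤ) * (b 1 - b 0) := by
    intro i
    induction i with
    | zero => intro _; constructor <;> push_cast <;> ring
    | succ i ih =>
      intro hi
      obtain ⟨h1, h2⟩ := ih (by omega)
      refine ⟨h2, ?_⟩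
      have e0 := hb i (by omega)
      have e1 := hb (i + 1) (by omega)
      have e2 := hb (i + 1 + 1) hi
      have := h _ e0.1 _ e1.1 _ e2.1 (by rw [e0.2, e1.2, e2.2]; push_cast; ring)
      have e3 : b (i + 1 + 1) = 2 * b (i + 1) - b i := by linarith
      rw [e3, h1, h2]; push_cast; ring
  apply hB (b 0) (b 1 - b 0)
  · intro h0
    have e0 := hb 0 (by omega)
    have e1 := hb 1 (by omega)
    have : b 1 = b 0 := by linarith
    rw [this, e0.2] at e1
    apply hd
    have := e1.2
    push_cast at this
    linarith
  · rw [subset_AP_iff]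
    intro i hi
    have : b 0 + i * (b 1 - b 0) = b i := by
      rcases i with _ | i
      · push_cast; ring
      · exact ((key i hi).2).symm
    rw [this]
    exact (hb i hi).1

/-- Ruzsa-type modelling. -/
lemma model (B D : Finset ℤ) (hD : ∀ x ∈ B, ∀ y ∈ B, ∀ z ∈ B, x + z - 2 * y ∈ D)
    (hD0 : 0 < D.card) :
    ∃ φ : ℤ → ℤ, (∀ x, 0 ≤ φ x ∧ φ x < (8 * D.card + 1 : ℕ)) ∧
      ∀ x ∈ B, ∀ y ∈ B, ∀ z ∈ B, φ x + φ z = 2 * φ y → x + z = 2 * y := by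
  classical
  obtain ⟨L, hL0, hL⟩ : ∃ L : ℕ, 0 < L ∧ ∀ d ∈ D, |d| < L := by
    refine ⟨∑ d ∈ D, d.natAbs + 1, by omega, fun d hd => ?_⟩
    have := single_le_sum (f := fun d : ℤ => d.natAbs) (fun _ _ => Nat.zero_le _) hd
    rw [Int.abs_eq_natAbs]
    omega
  obtain ⟨P, hP, hP1, hP2⟩ := Nat.exists_prime_lt_and_le_two_mul (4 * L * D.card) (by positivity)
  have : Fact P.Prime := ⟨hP⟩
  -- bad dilations
  let bad : Finset (ZMod P) := insert 0 (((D.erase 0) ×ˢ (Finset.Ioo (-(2 * L : ℤ)) (2 * L)).erase 0).image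
    (fun w => (w.2 : ZMod P) * (w.1 : ZMod P)⁻¹))
  have hbad : bad.card < (Finset.univ : Finset (ZMod P)).card := by
    rw [card_univ, ZMod.card]
    have h1 : bad.card ≤ ((D.erase 0) ×ˢ (Finset.Ioo (-(2 * L : ℤ)) (2 * L)).erase 0).card + 1 :=
      (card_insert_le _ _).trans (Nat.add_le_add_right card_image_le 1)
    have h2 : ((Finset.Ioo (-(2 * L : ℤ)) (2 * L)).erase 0).card ≤ 4 * L - 2 := by
      rw [card_erase_of_mem (by simp; omega), Int.card_Ioo]; omega
    rw [card_product] at h1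
    have h3 : (D.erase 0).card * ((Finset.Ioo (-(2 * L : ℤ)) (2 * L)).erase 0).card ≤
        D.card * (4 * L - 2) := Nat.mul_le_mul (card_le_card (erase_subset _ _)) h2
    have h4 : D.card * (4 * L - 2) + 2 * D.card = 4 * L * D.card := by
      rw [mul_comm 2, ← mul_add, mul_comm]; congr 1; omega
    omega
  obtain ⟨q, -, hq⟩ := exists_mem_notMem_of_card_lt_card hbad
  have hq0 : q ≠ 0 := by
    rintro rfl; exact hq (mem_insert_self _ _)
  let r : ℤ → ℤ := fun x => ((q * (x : ZMod P)).val : ℤ)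
  have hr : ∀ x : ℤ, ((r x : ℤ) : ZMod P) = q * x := by
    intro x; simp [r]
  have hr0 : ∀ x, 0 ≤ r x ∧ r x < P := by
    intro x; exact ⟨by positivity, Int.ofNat_lt.2 (ZMod.val_lt (q * (x : ZMod P)))⟩
  have hLz : (0 : ℤ) < L := by exact_mod_cast hL0
  refine ⟨fun x => r x / L, fun x => ⟨Int.ediv_nonneg (hr0 x).1 hLz.le, ?_⟩, ?_⟩
  · have : r x < (8 * D.card + 1) * L := by
      have := (hr0 x).2
      have h2 : (P : ℤ) ≤ 2 * (4 * L * D.card) := by exact_mod_cast hP2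
      nlinarith
    push_cast
    exact Int.ediv_lt_of_lt_mul hLz this
  · intro x hx y hy z hz h
    by_contra hne
    have hd : x + z - 2 * y ≠ 0 := fun h => hne (by linarith)
    have hdD := hD x hx y hy z hz
    have hdabs := hL _ hdD
    have hdP : ((x + z - 2 * y : ℤ) : ZMod P) ≠ 0 := by
      rw [Ne, ZMod.intCast_zmod_eq_zero_iff_dvd]
      intro hdvd
      have := Int.le_of_dvd (abs_pos.2 hd) ((dvd_abs _ _).2 hdvd)
      have h2 : (4 * L * D.card : ℤ) < P := by exact_mod_cast hP1
      have h3 : (1 : ℤ) ≤ D.card := by exact_mod_cast hD0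
      nlinarith
    set u := r x + r z - 2 * r y with hu
    have huZ : (u : ZMod P) = q * ((x + z - 2 * y : ℤ) : ZMod P) := by
      rw [hu]; push_cast; rw [hr, hr, hr]; ring
    have hu0 : u ≠ 0 := by
      intro h0
      rw [h0] at huZ
      exact mul_ne_zero hq0 hdP (by rw [← huZ]; simp)
    have hub : u ∈ Finset.Ioo (-(2 * L : ℤ)) (2 * L) := by
      have ex := Int.mul_ediv_add_emod (r x) L
      have ey := Int.mul_ediv_add_emod (r y) L
      have ez := Int.mul_ediv_add_emod (r z) L
      have : u = r x % L + r z % L - 2 * (r y % L) := by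
        have : (L : ℤ) * (r x / L) + L * (r z / L) = 2 * (L * (r y / L)) := by
          rw [← mul_add, h]; ring
        linarith
      have x0 := Int.emod_nonneg (r x) hLz.ne'
      have y0 := Int.emod_nonneg (r y) hLz.ne'
      have z0 := Int.emod_nonneg (r z) hLz.ne'
      have x1 := Int.emod_lt_of_pos (r x) hLz
      have y1 := Int.emod_lt_of_pos (r y) hLz
      have z1 := Int.emod_lt_of_pos (r z) hLz
      rw [mem_Ioo]; constructor <;> linarith
    apply hq
    refine mem_insert_of_mem (mem_image.2 ⟨(x + z - 2 * y, u), ?_, ?_⟩)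
    · exact mem_product.2 ⟨mem_erase.2 ⟨hd, hdD⟩, mem_erase.2 ⟨hu0, hub⟩⟩
    · show (u : ZMod P) * _ = q
      rw [huZ, mul_assoc, mul_inv_cancel₀ hdP, mul_one]

/-- The graph of pairs whose midpoint lies in `A`. -/
def midGraph (A : Finset ℤ) : Finset (ℤ × ℤ) :=
  (A ×ˢ A).filter (fun e => e.1 + e.2 ∈ A.image (fun c => 2 * c))

lemma fAP_le_s3 (A : Finset ℤ) : fAP 3 A ≤ (midGraph A).card := by
  classical
  let F : Finset (Finset ℤ) := (midGraph A).image (fun e => AP 3 e.1 ((e.2 - e.1) / 2))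
  have h : fAP 3 A ≤ F.card := by
    have hFc : Nat.card (F : Set (Finset ℤ)) = F.card := by simp
    rw [fAP, ← hFc]
    apply Nat.card_mono (Set.toFinite _)
    rintro P ⟨hPA, x, d, hd, rfl⟩
    rw [← coe_subset, subset_AP_iff] at hPA
    rw [mem_coe]
    refine mem_image.2 ⟨(x, x + 2 * d), mem_filter.2 ⟨mem_product.2 ⟨?_, ?_⟩, ?_⟩, ?_⟩
    · simpa using hPA 0 (by norm_num)
    · simpa using hPA 2 (by norm_num)
    · refine mem_image.2 ⟨x + d, by simpa using hPA 1 (by norm_num), by ring⟩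
    · show AP 3 x ((x + 2 * d - x) / 2) = _
      congr 1
      omega
  exact h.trans card_image_le

lemma sub_card (A B : Finset ℤ) (L : ℕ)
    (h : ∀ a ∈ B, ∀ a' ∈ B, L ≤ pathCount A A (midGraph A) a a') :
    (B - B).card * L ≤ A.card ^ 4 := by
  classical
  let S := A.image (fun c : ℤ => 2 * c)
  have hS : S.card ≤ A.card := card_image_le
  let f : ℤ × ℤ × ℤ × ℤ → ℤ := fun s => s.1 - s.2.1 + s.2.2.1 - s.2.2.2
  let Q := S ×ˢ S ×ˢ S ×ˢ S
  have hQ : Q.card ≤ A.card ^ 4 := by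
    simp only [Q, card_product]
    calc _ = S.card ^ 4 := by ring
      _ ≤ _ := Nat.pow_le_pow_left hS 4
  refine le_trans ?_ hQ
  refine le_trans ?_ (card_le_card (filter_subset (fun s => f s ∈ B - B) Q))
  rw [card_eq_sum_card_fiberwise (s := Q.filter (fun s => f s ∈ B - B)) (f := f)
    (t := B - B) (fun s hs => (mem_filter.1 (mem_coe.1 hs)).2)]
  rw [← smul_eq_mul, ← sum_const]
  apply sum_le_sum
  intro d hd
  obtain ⟨a, ha, a', ha', rfl⟩ := mem_sub.1 hd
  refine (h a ha a' ha').trans ?_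
  rw [pathCount]
  refine card_le_card_of_injOn
    (fun t => (a + t.1, t.2.1 + t.1, t.2.1 + t.2.2, a' + t.2.2)) ?_ ?_
  · rintro ⟨b, c, b'⟩ ht
    have ht := mem_filter.1 (mem_coe.1 ht)
    simp only at ht
    obtain ⟨-, h1, h2, h3, h4⟩ := ht
    have hf : f (a + b, c + b, c + b', a' + b') = a - a' := by simp only [f]; ring
    refine mem_coe.2 (mem_filter.2 ⟨mem_filter.2 ⟨?_, by rw [hf]; exact hd⟩, hf⟩)
    exact mem_product.2 ⟨(mem_filter.1 h1).2, mem_product.2 ⟨(mem_filter.1 h2).2,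
      mem_product.2 ⟨(mem_filter.1 h3).2, (mem_filter.1 h4).2⟩⟩⟩
  · rintro ⟨b, c, b'⟩ - ⟨b1, c1, b1'⟩ - he
    simp only [Prod.mk.injEq] at he ⊢
    omega

lemma pluennecke4 (B : Finset ℤ) (hB : B.Nonempty) :
    ((2 • B - 2 • B).card : ℝ) * (B.card : ℝ) ^ 3 ≤ ((B - B).card : ℝ) ^ 4 := by
  have h := pluennecke_ruzsa_inequality_nsmul_sub_nsmul_sub hB B 2 2
  have h' : ((2 • B - 2 • B).card : ℝ) ≤ ((B - B).card / B.card : ℝ) ^ (2 + 2) * B.card := by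
    have h2 := (NNRat.cast_le (K := ℝ)).2 h
    push_cast at h2
    exact h2
  have hb : (0 : ℝ) < B.card := by exact_mod_cast hB.card_pos
  calc _ ≤ ((B - B).card / B.card : ℝ) ^ (2 + 2) * B.card * (B.card : ℝ) ^ 3 := by gcongr
    _ = _ := by rw [div_pow]; field_simp; ring

theorem three_ap_upper_bound :
    ∃ c : ℝ, 0 < c ∧ ∀ k : ℕ, 4 ≤ k →
      ∃ n₀ : ℕ, ∀ n : ℕ, n₀ ≤ n → ∀ (A : Finset ℤ) (p : ℝ),
        A.card = n → APFree k ↑A → 0 < p → p < 1 →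
        (fAP 3 A : ℝ) = p * (n : ℝ) ^ 2 →
        p ^ 25 ≤ c * (rk k n : ℝ) / n := by
  refine ⟨2 * (64 * 4096 ^ 4 + 2), by positivity, fun k hk => ⟨1, fun n hn A p hAn hfree hp hp1 hf => ?_⟩⟩
  have hA : 0 < A.card := by omega
  have hnpos : (0 : ℝ) < n := by exact_mod_cast hn
  have hE : p * (A.card : ℝ) ^ 2 ≤ (midGraph A).card := by
    rw [hAn, ← hf]; exact_mod_cast fAP_le_s3 A
  obtain ⟨B, hBA, hBc, hpath⟩ := bsg_graph A (midGraph A) (filter_subset _ _) p hp hA hE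
  rw [hAn] at hBc hpath
  have hBpos : (0 : ℝ) < B.card := lt_of_lt_of_le (by positivity) hBc
  have hBne : B.Nonempty := card_pos.1 (by exact_mod_cast hBpos)
  -- size of the difference set
  have hdiff : ((B - B).card : ℝ) * (p ^ 5 * (n : ℝ) ^ 3 / 4096) ≤ (n : ℝ) ^ 4 := by
    have h1 := sub_card A B ⌈p ^ 5 * (n : ℝ) ^ 3 / 4096⌉₊
      (fun a ha a' ha' => Nat.ceil_le.2 (hpath a ha a' ha'))
    rw [hAn] at h1
    have h2 : ((B - B).card : ℝ) * (⌈p ^ 5 * (n : ℝ) ^ 3 / 4096⌉₊ : ℝ) ≤ (n : ℝ) ^ 4 := by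
      exact_mod_cast h1
    refine le_trans ?_ h2
    gcongr
    exact Nat.le_ceil _
  have hdiff2 : ((B - B).card : ℝ) * p ^ 5 ≤ 4096 * n := by
    have : (n : ℝ) ^ 3 * (((B - B).card : ℝ) * p ^ 5) ≤ (n : ℝ) ^ 3 * (4096 * n) := by nlinarith
    exact le_of_mul_le_mul_left this (by positivity)
  set D := 2 • B - 2 • B with hD
  have hDmem : ∀ x ∈ B, ∀ y ∈ B, ∀ z ∈ B, x + z - 2 * y ∈ D := by
    intro x hx y hy z hz
    rw [hD, two_nsmul, two_mul]
    exact sub_mem_sub (add_mem_add hx hz) (add_mem_add hy hy)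
  have hDpos : 0 < D.card := by
    obtain ⟨x, hx⟩ := hBne
    exact card_pos.2 ⟨_, hDmem x hx x hx x hx⟩
  have hpl := pluennecke4 B hBne
  rw [← hD] at hpl
  have hDb : (D.card : ℝ) * p ^ 23 ≤ 8 * 4096 ^ 4 * n := by
    have e1 : (D.card : ℝ) * (p * n / 2) ^ 3 * p ^ 20 ≤ (4096 * n) ^ 4 := by
      calc (D.card : ℝ) * (p * n / 2) ^ 3 * p ^ 20 ≤ D.card * (B.card : ℝ) ^ 3 * p ^ 20 := by gcongr
        _ ≤ ((B - B).card : ℝ) ^ 4 * p ^ 20 := by gcongr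
        _ = (((B - B).card : ℝ) * p ^ 5) ^ 4 := by ring
        _ ≤ _ := by gcongr
    have e2 : (n : ℝ) ^ 3 * ((D.card : ℝ) * p ^ 23) ≤ (n : ℝ) ^ 3 * (8 * 4096 ^ 4 * n) := by
      calc _ = 8 * ((D.card : ℝ) * (p * n / 2) ^ 3 * p ^ 20) := by ring
        _ ≤ 8 * (4096 * n) ^ 4 := by gcongr
        _ = _ := by ring
    exact le_of_mul_le_mul_left e2 (by positivity)
  obtain ⟨φ, hφ, hφB⟩ := model B D hDmem hDpos
  have hfreeB : APFree k ↑B := hfree.mono (by exact_mod_cast hBA)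
  have hfreeC := APFree_image k (by omega) B hfreeB φ hφB
  have hcardC : (B.image φ).card = B.card := by
    apply card_image_of_injOn
    intro x hx y hy hxy
    have := hφB x hx y hy x hx (by rw [hxy]; ring)
    omega
  have hfin := density_transfer k n (8 * D.card + 1) hn (B.image φ)
    (fun x hx => by obtain ⟨y, -, rfl⟩ := mem_image.1 hx; exact hφ y) hfreeC
  rw [hcardC] at hfin
  have hfin' : (B.card : ℝ) * n ≤ (8 * D.card + 1 + n) * (rk k n : ℝ) := by exact_mod_cast hfin
  set R : ℝ := (rk k n : ℝ) with hR
  have hR0 : 0 ≤ R := by positivity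
  have hn1 : (1 : ℝ) ≤ n := by exact_mod_cast hn
  have hp23 : p ^ 23 ≤ 1 := pow_le_one₀ hp.le hp1.le
  have key : (p ^ 24 * n) * n ≤ (2 * (64 * 4096 ^ 4 + 2) * R) * n := by
    calc (p ^ 24 * n) * n = 2 * (p * n / 2 * n) * p ^ 23 := by ring
      _ ≤ 2 * (B.card * n) * p ^ 23 := by gcongr
      _ ≤ 2 * ((8 * D.card + 1 + n) * R) * p ^ 23 := by gcongr
      _ = 2 * (8 * (D.card * p ^ 23) + 1 * p ^ 23 + n * p ^ 23) * R := by ring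
      _ ≤ 2 * (8 * (8 * 4096 ^ 4 * n) + n * 1 + n * 1) * R := by gcongr
      _ = _ := by ring
  have key2 := le_of_mul_le_mul_right key hnpos
  rw [le_div_iff₀ hnpos]
  refine le_trans ?_ key2
  gcongr ?_ * _
  exact pow_le_pow_of_le_one hp.le hp1.le (by norm_num)
end
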